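/- arXiv:2511.09267 — 9 statements merged into one kernel-verified Lean document; each statement's English description precedes it below -/
import Mathlib

section
/- Let A assign a matrix A_b ∈ M_K(ℂ) to each b ∈ Her 𝒴_{≤M}. If there is an ε > 0 such that for every separable complex Hilbert space F and every unitary representation π of 𝔜 on F one has ⟨A(π)ξ, ξ⟩ ≥ ε‖ξ‖² for all ξ ∈ F^K, then there exist positive integers K′ and M′ and a family of K′×K complex matrices B_a indexed by a ∈ 𝒴_{≤M′} such that for every α ∈ 𝔜 the coefficient A_α (set equal to 0 when α ∉ Her 𝒴_{≤M}) equals the sum of B_a* B_b over all pairs a, b ∈ 𝒴_{≤M′} with a⁻¹b = α. -/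
open scoped ComplexInnerProductSpace
open Matrix

/-- `𝒴_{≤ M}`: products of at most `M` of the generators `y`. -/
def Yle {h : ℕ} {Y : Type*} [Group Y] (y : Fin h → Y) (M : ℕ) : Set Y :=
  {a | ∃ l : List (Fin h), l.length ≤ M ∧ (l.map y).prod = a}

/-- `Her 𝒴_{≤ M} = {a⁻¹ b : a, b ∈ 𝒴_{≤ M}}`. -/
def HerYle {h : ℕ} {Y : Type*} [Group Y] (y : Fin h → Y) (M : ℕ) : Set Y :=
  {η | ∃ a ∈ Yle y M, ∃ b ∈ Yle y M, a⁻¹ * b = η}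

open UniformSpace in
lemma exists_unitaryRep_of_core {G V : Type} [Group G] [AddCommGroup V] [Module ℂ V]
    (c : PreInnerProductSpace.Core ℂ V) (ρ : G →* (V →ₗ[ℂ] V))
    (hρ : ∀ g u v, c.inner (ρ g u) (ρ g v) = c.inner u v)
    {s : Set V} (hs : s.Countable) (hspan : Submodule.span ℂ s = ⊤) :
    ∃ (F : Type) (_ : NormedAddCommGroup F) (_ : InnerProductSpace ℂ F) (_ : CompleteSpace F)
      (_ : TopologicalSpace.SeparableSpace F) (π : G →* (F ≃ₗᵢ[ℂ] F)) (Λ : V →ₗ[ℂ] F),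
      (∀ u v, ⟪Λ u, Λ v⟫ = c.inner u v) ∧ ∀ g u, π g (Λ u) = Λ (ρ g u) := by
  let _ : SeminormedAddCommGroup V := InnerProductSpace.Core.toSeminormedAddCommGroup (c := c)
  let _ : InnerProductSpace ℂ V := InnerProductSpace.ofCore c
  have hinner (u v : V) : ⟪u, v⟫ = c.inner u v := rfl
  have hsep : TopologicalSpace.SeparableSpace V := by
    have h := hs.isSeparable.span (R := ℂ)
    rw [hspan] at h
    exact TopologicalSpace.isSeparable_univ_iff.mp h
  have hnorm (g : G) (v : V) : ‖ρ g v‖ = ‖v‖ := by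
    rw [@norm_eq_sqrt_re_inner ℂ, @norm_eq_sqrt_re_inner ℂ V, hinner, hinner, hρ]
  let T (g : G) : V →L[ℂ] V :=
    (⟨ρ g, hnorm g⟩ : V →ₗᵢ[ℂ] V).toContinuousLinearMap
  have hT (g : G) (v : V) : (T g).completion (v : Completion V) = (ρ g v : V) := by
    simp [T]
  have hmul (g k : G) (x : Completion V) :
      (T g).completion ((T k).completion x) = (T (g * k)).completion x := by
    induction x using Completion.induction_on with
    | hp => apply isClosed_eq <;> fun_prop
    | ih v => rw [hT, hT, hT, map_mul, Module.End.mul_apply]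
  have hone (x : Completion V) : (T 1).completion x = x := by
    induction x using Completion.induction_on with
    | hp => apply isClosed_eq <;> fun_prop
    | ih v => rw [hT, map_one, Module.End.one_apply]
  have hiso (g : G) (x : Completion V) : ‖(T g).completion x‖ = ‖x‖ := by
    induction x using Completion.induction_on with
    | hp => apply isClosed_eq <;> fun_prop
    | ih v => rw [hT, Completion.norm_coe, Completion.norm_coe, hnorm]
  let U (g : G) : Completion V ≃ₗᵢ[ℂ] Completion V :=
    { toLinearEquiv := LinearEquiv.ofLinearMap (σ₂₁ := RingHom.id ℂ)
        (T g).completion.toLinearMap (T g⁻¹).completion.toLinearMap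
        (by ext x; simp [hmul, hone]) (by ext x; simp [hmul, hone])
      norm_map' := hiso g }
  have hU (g : G) (x : Completion V) : U g x = (T g).completion x := rfl
  refine ⟨Completion V, inferInstance, inferInstance, inferInstance, inferInstance,
    ⟨⟨U, ?_⟩, ?_⟩, (Completion.toComplₗᵢ (𝕜 := ℂ) (E := V)).toLinearMap, ?_, ?_⟩
  · ext x
    simp [hU, hone]
  · intro g k
    ext x
    simp [hU, hmul]
  · intro u v
    simp [hinner]
  · intro g u
    simp [hU, hT]

lemma PointedCone.exists_nonneg_of_notMem {E : Type*} [AddCommGroup E] [Module ℝ E]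
    (C : PointedCone ℝ E) {e a : E} (he : e ∈ C) (hunit : ∀ x, ∃ t : ℝ, t • e + x ∈ C)
    (ha : a ∉ C) :
    ∃ L : E →ₗ[ℝ] ℝ, (∀ x ∈ C, 0 ≤ L x) ∧ L e = 1 ∧ L a ≤ 0 := by
  have hsmul {t : ℝ} (ht : 0 ≤ t) {x : E} (hx : x ∈ C) : t • x ∈ C := PointedCone.smul_mem C ht hx
  have hneg : -e ∉ C := by
    intro h
    obtain ⟨t, ht⟩ := hunit a
    apply ha
    have h1 : |t| • e + a ∈ C := by
      have := C.add_mem ht (hsmul (sub_nonneg.2 (le_abs_self t)) he)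
      convert this using 1
      module
    convert C.add_mem h1 (hsmul (abs_nonneg t) h) using 1
    module
  have he0 : e ≠ 0 := by
    rintro rfl
    exact hneg (by simp)
  let S : PointedCone ℝ E := C ⊔ PointedCone.hull ℝ {-a}
  have hS {c : ℝ} (hc : c • e ∈ S) : 0 ≤ c := by
    by_contra! hlt
    obtain ⟨x, hx, z, hz, hxz⟩ := Submodule.mem_sup.1 hc
    obtain ⟨r, rfl⟩ := Submodule.mem_span_singleton.1 hz
    have hx' : x = c • e + (r : ℝ) • a := by
      rw [← hxz, show r • -a = (r : ℝ) • -a from rfl]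
      module
    rcases eq_or_lt_of_le r.2 with h0 | h0
    · apply hneg
      rw [← h0, zero_smul, add_zero] at hx'
      convert hsmul (t := (-c)⁻¹) (by rw [inv_nonneg]; linarith) hx using 1
      rw [hx', smul_smul, ← neg_one_smul ℝ]
      congr 1
      field_simp [hlt.ne]
    · apply ha
      have h1 := hsmul (inv_nonneg.2 h0.le) hx
      have h2 := hsmul (t := (r : ℝ)⁻¹ * (-c)) (mul_nonneg (inv_nonneg.2 h0.le) (by linarith)) he
      convert C.add_mem h1 h2 using 1
      rw [hx', smul_add, smul_smul, smul_smul, inv_mul_cancel₀ (ne_of_gt h0)]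
      module
  obtain ⟨L, hL, hpos⟩ := riesz_extension S
    (LinearPMap.mkSpanSingleton (σ := RingHom.id ℝ) e (1 : ℝ) he0) (by
      rintro ⟨x, hx⟩ hxS
      obtain ⟨c, rfl⟩ := Submodule.mem_span_singleton.1 hx
      rw [LinearPMap.mkSpanSingleton'_apply]
      simpa using hS hxS) (by
      intro x
      obtain ⟨t, ht⟩ := hunit x
      exact ⟨⟨t • e, Submodule.mem_span_singleton.2 ⟨t, rfl⟩⟩, (le_sup_left : C ≤ S) ht⟩)
  refine ⟨L, fun x hx => hpos x ((le_sup_left : C ≤ S) hx), ?_, ?_⟩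
  · have := hL ⟨e, Submodule.mem_span_singleton_self e⟩
    rw [this]
    have h2 := LinearPMap.mkSpanSingleton_apply ℝ ℝ (σ := RingHom.id ℝ) he0 (1 : ℝ)
    exact h2
  · have := hpos (-a) ((le_sup_right : _ ≤ S) (Submodule.subset_span rfl))
    simpa using this

section HermProd

variable {G ι : Type*} [Group G]

/-- The matrix entries of `u* v` for row vectors `u`, `v` over the group algebra `ℂ[G]`. -/
noncomputable def hermProd :
    ((G × ι) →₀ ℂ) →ₗ⋆[ℂ] ((G × ι) →₀ ℂ) →ₗ[ℂ] ((G × ι × ι) →₀ ℂ) :=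
  LinearMap.mk₂'ₛₗ _ _
    (fun u v => u.sum fun p c => v.sum fun q d =>
      Finsupp.single (p.1⁻¹ * q.1, p.2, q.2) (star c * d))
    (fun u u' v => Finsupp.sum_add_index' (by simp)
      (by simp [add_mul, Finsupp.sum_add, Finsupp.single_add]))
    (fun c u v => by
      rw [Finsupp.sum_smul_index' (by simp), Finsupp.smul_sum]
      simp [Finsupp.smul_sum, mul_assoc, -Finsupp.single_mul])
    (fun u v v' => by
      rw [← Finsupp.sum_add]
      refine Finsupp.sum_congr fun p _ => Finsupp.sum_add_index' (by simp)
        (by simp [mul_add, Finsupp.single_add]))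
    (fun c u v => by
      rw [Finsupp.smul_sum]
      refine Finsupp.sum_congr fun p _ => ?_
      rw [Finsupp.sum_smul_index' (by simp), Finsupp.smul_sum]
      simp [mul_left_comm, -Finsupp.single_mul])

lemma hermProd_single (p q : G × ι) (c d : ℂ) :
    hermProd (Finsupp.single p c) (Finsupp.single q d) =
      Finsupp.single (p.1⁻¹ * q.1, p.2, q.2) (star c * d) := by
  simp [hermProd]

/-- The adjoint of a matrix over the group algebra. -/
noncomputable def hermStar : ((G × ι × ι) →₀ ℂ) →ₗ⋆[ℂ] ((G × ι × ι) →₀ ℂ) where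
  toFun f := (Finsupp.equivMapDomain ((Equiv.inv G).prodCongr (Equiv.prodComm ι ι)) f).mapRange
    star (star_zero ℂ)
  map_add' f f' := by ext; simp
  map_smul' c f := by ext; simp

lemma hermStar_apply (f : (G × ι × ι) →₀ ℂ) (g : G) (i j : ι) :
    hermStar f (g, i, j) = star (f (g⁻¹, j, i)) := by
  simp [hermStar]

lemma hermStar_single (g : G) (i j : ι) (c : ℂ) :
    hermStar (Finsupp.single (g, i, j) c) = Finsupp.single (g⁻¹, j, i) (star c) := by
  simp [hermStar]

lemma hermStar_hermStar (f : (G × ι × ι) →₀ ℂ) : hermStar (hermStar f) = f := by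
  ext ⟨g, i, j⟩
  simp [hermStar_apply]

lemma hermStar_hermProd (u v : (G × ι) →₀ ℂ) : hermStar (hermProd u v) = hermProd v u := by
  induction u using Finsupp.induction_linear with
  | zero => simp
  | add u u' hu hu' => simp [hu, hu']
  | single p c =>
    induction v using Finsupp.induction_linear with
    | zero => simp
    | add v v' hv hv' => simp [hv, hv']
    | single q d => simp [hermProd_single, hermStar_single, mul_comm, -Finsupp.single_mul]

lemma hermProd_apply (u v : (G × ι) →₀ ℂ) (T : Finset G) (hT : ∀ a i, u (a, i) ≠ 0 → a ∈ T)
    (g : G) (i j : ι) :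
    hermProd u v (g, i, j) = ∑ a ∈ T, star (u (a, i)) * v (a * g, j) := by
  classical
  have key (v : (G × ι) →₀ ℂ) (p : G × ι) (c : ℂ) :
      hermProd (Finsupp.single p c) v (g, i, j) =
        if p.2 = i then star c * v (p.1 * g, j) else 0 := by
    induction v using Finsupp.induction_linear with
    | zero => simp
    | add v v' hv hv' => simp only [map_add, Finsupp.add_apply, hv, hv']; split_ifs <;> ring
    | single q d =>
      obtain ⟨b, l⟩ := q
      obtain ⟨a, k⟩ := p
      simp only [hermProd_single, Finsupp.single_apply, Prod.mk.injEq, inv_mul_eq_iff_eq_mul]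
      split_ifs <;> simp_all
  calc hermProd u v (g, i, j)
      = u.sum fun p c => hermProd (Finsupp.single p c) v (g, i, j) := by
        conv_lhs => rw [← Finsupp.sum_single u]
        simp [Finsupp.sum, Finsupp.finsetSum_apply]
    _ = ∑ a ∈ T, star (u (a, i)) * v (a * g, j) := by
        simp only [key, Finsupp.sum]
        rw [← Finset.sum_filter]
        symm
        refine Finset.sum_bij_ne_zero (fun a _ _ => (a, i)) ?_ ?_ ?_ ?_
        · intro a _ h
          simp only [Finset.mem_filter, Finsupp.mem_support_iff, and_true]
          intro h0
          simp [h0] at h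
        · simp
        · rintro ⟨a, k⟩ h _
          simp only [Finset.mem_filter, Finsupp.mem_support_iff] at h
          obtain ⟨h, rfl⟩ := h
          exact ⟨a, hT _ _ h, by assumption, rfl⟩
        · simp

/-- Left translation on row vectors over the group algebra. -/
noncomputable def leftTranslate (G ι : Type*) [Group G] :
    G →* (((G × ι) →₀ ℂ) →ₗ[ℂ] ((G × ι) →₀ ℂ)) where
  toFun g := (Finsupp.domLCongr ((Equiv.mulLeft g).prodCongr (Equiv.refl ι))).toLinearMap
  map_one' := by ext; simp
  map_mul' g k := by
    ext ⟨a, i⟩ : 2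
    simp [mul_assoc]

lemma leftTranslate_single (g a : G) (i : ι) (c : ℂ) :
    leftTranslate G ι g (Finsupp.single (a, i) c) = Finsupp.single (g * a, i) c := by
  simp [leftTranslate]

lemma leftTranslate_apply (g a : G) (i : ι) (u : (G × ι) →₀ ℂ) :
    leftTranslate G ι g u (a, i) = u (g⁻¹ * a, i) := by
  simp [leftTranslate]

lemma hermProd_leftTranslate (g : G) (u v : (G × ι) →₀ ℂ) :
    hermProd (leftTranslate G ι g u) (leftTranslate G ι g v) = hermProd u v := by
  induction u using Finsupp.induction_linear with
  | zero => simp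
  | add u u' hu hu' => simp [hu, hu']
  | single p c =>
    induction v using Finsupp.induction_linear with
    | zero => simp
    | add v v' hv hv' => simp [hv, hv']
    | single q d =>
      obtain ⟨a, k⟩ := p
      obtain ⟨b, l⟩ := q
      simp [hermProd_single, leftTranslate_single, mul_assoc]

/-- The cone of sums of hermitian squares `u* u`. -/
noncomputable def sosCone (G ι : Type*) [Group G] : PointedCone ℝ ((G × ι × ι) →₀ ℂ) :=
  PointedCone.hull ℝ (Set.range fun u : (G × ι) →₀ ℂ => hermProd u u)

lemma hermProd_self_mem_sosCone (u : (G × ι) →₀ ℂ) : hermProd u u ∈ sosCone G ι :=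
  Submodule.subset_span ⟨u, rfl⟩

lemma exists_eq_sum_hermProd {f : (G × ι × ι) →₀ ℂ} (hf : f ∈ sosCone G ι) :
    ∃ (n : ℕ) (u : Fin (n + 1) → (G × ι) →₀ ℂ), f = ∑ k, hermProd (u k) (u k) := by
  induction hf using Submodule.span_induction with
  | mem f hf =>
    obtain ⟨u, rfl⟩ := hf
    exact ⟨0, fun _ => u, by simp⟩
  | zero => exact ⟨0, 0, by simp⟩
  | add f f' _ _ hf hf' =>
    obtain ⟨m, u, rfl⟩ := hf
    obtain ⟨n, v, rfl⟩ := hf'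
    refine ⟨m + 1 + n, Fin.append (m := m + 1) (n := n + 1) u v, ?_⟩
    have := Fin.sum_univ_add fun k : Fin (m + 1 + (n + 1)) =>
      hermProd (Fin.append u v k) (Fin.append u v k)
    simp only [Fin.append_left, Fin.append_right] at this
    exact this.symm
  | smul r f _ hf =>
    obtain ⟨n, u, rfl⟩ := hf
    refine ⟨n, fun k => (Real.sqrt r : ℂ) • u k, ?_⟩
    rw [Finset.smul_sum]
    refine Finset.sum_congr rfl fun k _ => ?_
    rw [map_smul, LinearMap.map_smulₛₗ, LinearMap.smul_apply, smul_smul, Complex.conj_ofReal,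
      ← Complex.ofReal_mul, Real.mul_self_sqrt r.2]
    rfl

/-- The cone of matrices whose hermitian part is a sum of hermitian squares. -/
noncomputable def sosReCone (G ι : Type*) [Group G] : PointedCone ℝ ((G × ι × ι) →₀ ℂ) :=
  (sosCone G ι).comap
    { toFun f := f + hermStar f
      map_add' f f' := by simp only [map_add]; abel
      map_smul' r f := by ext ⟨g, i, j⟩; simp [hermStar_apply] }

lemma mem_sosReCone {f : (G × ι × ι) →₀ ℂ} :
    f ∈ sosReCone G ι ↔ f + hermStar f ∈ sosCone G ι := Iff.rfl

lemma single_diag_mem_sosCone (i : ι) : Finsupp.single (1, i, i) 1 ∈ sosCone G ι := by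
  simpa [hermProd_single] using hermProd_self_mem_sosCone (Finsupp.single ((1 : G), i) (1 : ℂ))

variable [Fintype ι]

/-- The identity matrix over the group algebra. -/
noncomputable def hermOne (G ι : Type*) [Group G] [Fintype ι] : (G × ι × ι) →₀ ℂ :=
  ∑ i, Finsupp.single (1, i, i) 1

lemma hermOne_mem_sosCone : hermOne G ι ∈ sosCone G ι :=
  Submodule.sum_mem _ fun i _ => single_diag_mem_sosCone i

lemma hermStar_hermOne : hermStar (hermOne G ι) = hermOne G ι := by
  simp [hermOne, hermStar_single]

lemma hermOne_sub_single_mem_sosCone (i : ι) :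
    hermOne G ι - Finsupp.single (1, i, i) 1 ∈ sosCone G ι := by
  classical
  rw [hermOne, ← Finset.sum_erase_eq_sub (Finset.mem_univ i)]
  exact Submodule.sum_mem _ fun i _ => single_diag_mem_sosCone i

lemma hermOne_mem_sosReCone : hermOne G ι ∈ sosReCone G ι := by
  rw [mem_sosReCone, hermStar_hermOne]
  exact add_mem hermOne_mem_sosCone hermOne_mem_sosCone

lemma exists_smul_hermOne_add_mem_sosReCone (f : (G × ι × ι) →₀ ℂ) :
    ∃ t : ℝ, t • hermOne G ι + f ∈ sosReCone G ι := by
  induction f using Finsupp.induction_linear with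
  | zero => exact ⟨1, by simpa using hermOne_mem_sosReCone⟩
  | add f f' hf hf' =>
    obtain ⟨t, ht⟩ := hf
    obtain ⟨t', ht'⟩ := hf'
    refine ⟨t + t', ?_⟩
    convert add_mem ht ht' using 1
    module
  | single p c =>
    obtain ⟨g, i, j⟩ := p
    refine ⟨(1 + ‖c‖ ^ 2) / 2, ?_⟩
    have h1 := hermProd_self_mem_sosCone
      (Finsupp.single ((1 : G), i) (1 : ℂ) + Finsupp.single (g, j) c)
    have h2 := hermOne_sub_single_mem_sosCone (G := G) i
    have h3 := PointedCone.smul_mem _ (sq_nonneg ‖c‖) (hermOne_sub_single_mem_sosCone (G := G) j)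
    rw [mem_sosReCone]
    convert add_mem (add_mem h1 h2) h3 using 1
    have hstar : hermStar (((1 + ‖c‖ ^ 2) / 2) • hermOne G ι) =
        ((1 + ‖c‖ ^ 2) / 2) • hermOne G ι := by
      rw [← Complex.coe_smul, LinearMap.map_smulₛₗ, hermStar_hermOne, Complex.conj_ofReal]
    have hc : (Finsupp.single ((1 : G), j, j) (star c * c) : (G × ι × ι) →₀ ℂ) =
        ‖c‖ ^ 2 • Finsupp.single (1, j, j) 1 := by
      rw [Finsupp.smul_single, ← Complex.coe_smul, Complex.star_def, Complex.conj_mul']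
      simp
    simp only [map_add, LinearMap.add_apply, hermProd_single, hstar, hermStar_single, inv_one,
      one_mul, mul_one, star_one, inv_mul_cancel, hc]
    module

end HermProd

section PositiveFunctional

variable {G ι : Type*} [Group G]

/-- The semi-inner product on row vectors induced by a positive functional. -/
noncomputable abbrev gnsCore (φ : ((G × ι × ι) →₀ ℂ) →ₗ[ℂ] ℂ)
    (hφ : ∀ u, 0 ≤ (φ (hermProd u u)).re) (hφs : ∀ f, φ (hermStar f) = star (φ f)) :
    PreInnerProductSpace.Core ℂ ((G × ι) →₀ ℂ) where
  inner u v := φ (hermProd u v)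
  conj_inner_symm u v := by
    rw [← hermStar_hermProd, hφs]
    exact star_star _
  re_inner_nonneg := hφ
  add_left u v w := by simp
  smul_left u v c := by simp

lemma exists_unitaryRep_of_functional {G ι : Type} [Group G] [Countable G] [Countable ι]
    (φ : ((G × ι × ι) →₀ ℂ) →ₗ[ℂ] ℂ)
    (hφ : ∀ u, 0 ≤ (φ (hermProd u u)).re) (hφs : ∀ f, φ (hermStar f) = star (φ f)) :
    ∃ (F : Type) (_ : NormedAddCommGroup F) (_ : InnerProductSpace ℂ F) (_ : CompleteSpace F)
      (_ : TopologicalSpace.SeparableSpace F) (π : G →* (F ≃ₗᵢ[ℂ] F))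
      (Λ : ((G × ι) →₀ ℂ) →ₗ[ℂ] F),
      (∀ u v, ⟪Λ u, Λ v⟫ = φ (hermProd u v)) ∧
        ∀ g u, π g (Λ u) = Λ (leftTranslate G ι g u) :=
  exists_unitaryRep_of_core (gnsCore φ hφ hφs) (leftTranslate G ι)
    (fun g u v => congrArg φ (hermProd_leftTranslate g u v))
    (Set.countable_range fun p : G × ι => Finsupp.single p (1 : ℂ))
    (by simpa using (Finsupp.basisSingleOne (R := ℂ) (ι := G × ι)).span_eq)

lemma exists_functional_of_notMem [Fintype ι] {f : (G × ι × ι) →₀ ℂ} (hf : f ∉ sosReCone G ι) :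
    ∃ φ : ((G × ι × ι) →₀ ℂ) →ₗ[ℂ] ℂ, (∀ u, 0 ≤ (φ (hermProd u u)).re) ∧
      (∀ f, φ (hermStar f) = star (φ f)) ∧ (φ (hermOne G ι)).re = 1 ∧ (φ f).re ≤ 0 := by
  obtain ⟨L, hL, hL1, hLf⟩ := PointedCone.exists_nonneg_of_notMem (sosReCone G ι)
    hermOne_mem_sosReCone exists_smul_hermOne_add_mem_sosReCone hf
  have hre (x : (G × ι × ι) →₀ ℂ) : (Module.Dual.extendRCLike (𝕜 := ℂ) L x).re = L x := by
    simp [Module.Dual.extendRCLike_apply]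
  have him (x : (G × ι × ι) →₀ ℂ) :
      (Module.Dual.extendRCLike (𝕜 := ℂ) L x).im = -L (Complex.I • x) := by
    simp [Module.Dual.extendRCLike_apply]
  have hstar (x : (G × ι × ι) →₀ ℂ) : L (hermStar x) = L x := by
    have h1 := hL (hermStar x - x) (by simp [mem_sosReCone, hermStar_hermStar])
    have h2 := hL (x - hermStar x) (by simp [mem_sosReCone, hermStar_hermStar])
    rw [map_sub] at h1 h2
    linarith
  refine ⟨Module.Dual.extendRCLike L, fun u => ?_, fun x => ?_, ?_, ?_⟩
  · rw [hre]
    apply hL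
    rw [mem_sosReCone, hermStar_hermProd]
    exact add_mem (hermProd_self_mem_sosCone u) (hermProd_self_mem_sosCone u)
  · apply Complex.ext
    · simp [hre, hstar]
    · rw [Complex.star_def, Complex.conj_im, him, him, ← hstar (Complex.I • x),
        LinearMap.map_smulₛₗ]
      simp
  · rw [hre, hL1]
  · rwa [hre]

end PositiveFunctional

lemma eq_star_of_im_self_eq_zero {W : Type*} [AddCommGroup W] [Module ℂ W] (Q : W → W → ℂ)
    (hadd_left : ∀ x y z, Q (x + y) z = Q x z + Q y z)
    (hadd_right : ∀ x y z, Q x (y + z) = Q x y + Q x z)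
    (hI_left : ∀ x y, Q (Complex.I • x) y = -Complex.I * Q x y)
    (hI_right : ∀ x y, Q x (Complex.I • y) = Complex.I * Q x y)
    (him : ∀ x, (Q x x).im = 0) (x y : W) : Q x y = star (Q y x) := by
  have h1 := him (x + y)
  have h2 := him (x + Complex.I • y)
  simp only [hadd_left, hadd_right, hI_left, hI_right, Complex.add_im, Complex.mul_im,
    Complex.mul_re, Complex.neg_re, Complex.neg_im, Complex.I_re, Complex.I_im, him] at h1 h2
  apply Complex.ext
  · simp only [Complex.star_def, Complex.conj_re]
    linarith
  · simp only [Complex.star_def, Complex.conj_im]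
    linarith

section Generators

variable {h : ℕ} {Y : Type*} [Group Y] (y : Fin h → Y)

lemma finite_Yle (M : ℕ) : (Yle y M).Finite :=
  ((List.finite_length_le (Fin h) M).image fun l => (l.map y).prod).subset
    fun _ ⟨l, hl, hla⟩ => ⟨l, hl, hla⟩

lemma finite_HerYle (M : ℕ) : (HerYle y M).Finite :=
  (((finite_Yle y M).prod (finite_Yle y M)).image fun p => p.1⁻¹ * p.2).subset
    fun _ ⟨a, ha, b, hb, hab⟩ => ⟨(a, b), ⟨ha, hb⟩, hab⟩

variable {y}

lemma mul_mem_Yle {a b : Y} {m n : ℕ} (ha : a ∈ Yle y m) (hb : b ∈ Yle y n) :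
    a * b ∈ Yle y (m + n) := by
  obtain ⟨l, hl, rfl⟩ := ha
  obtain ⟨l', hl', rfl⟩ := hb
  exact ⟨l ++ l', by simp; omega, by simp⟩

lemma Yle_mono {m n : ℕ} (hmn : m ≤ n) : Yle y m ⊆ Yle y n :=
  fun _ ⟨l, hl, hla⟩ => ⟨l, hl.trans hmn, hla⟩

lemma countable_of_left_fractions
    (hY : ∀ η : Y, ∃ a b : List (Fin h), ((a.map y).prod)⁻¹ * (b.map y).prod = η) :
    Countable Y :=
  Function.Surjective.countable
    (f := fun p : List (Fin h) × List (Fin h) => ((p.1.map y).prod)⁻¹ * (p.2.map y).prod)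
    fun η => let ⟨a, b, hab⟩ := hY η; ⟨(a, b), hab⟩

/-- Common left denominators for finitely many left fractions. -/
lemma exists_mul_mem_Yle
    (hY : ∀ η : Y, ∃ a b : List (Fin h), ((a.map y).prod)⁻¹ * (b.map y).prod = η)
    (T : Finset Y) : ∃ (g : Y) (M : ℕ), 0 < M ∧ ∀ a ∈ T, g * a ∈ Yle y M := by
  classical
  induction T using Finset.induction_on with
  | empty => exact ⟨1, 1, one_pos, by simp⟩
  | insert a T _ ih =>
    obtain ⟨g, M, hM, hg⟩ := ih
    obtain ⟨c, d, hcd⟩ := hY (g * a)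
    refine ⟨(c.map y).prod * g, c.length + M + d.length, by omega, fun b hb => ?_⟩
    rcases Finset.mem_insert.1 hb with rfl | hb
    · refine ⟨d, by omega, ?_⟩
      rw [mul_assoc, ← hcd, mul_inv_cancel_left]
    · rw [mul_assoc]
      exact Yle_mono (Nat.le_add_right _ _) (mul_mem_Yle ⟨c, le_rfl, rfl⟩ (hg b hb))

lemma finsum_factorization_apply {K K' : ℕ} {M : ℕ} (B : Y → Matrix (Fin K') (Fin K) ℂ)
    (hB : ∀ a, B a ≠ 0 → a ∈ Yle y M) (α : Y) (i j : Fin K) :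
    (∑ᶠ a ∈ Yle y M, ∑ᶠ b ∈ {b : Y | b ∈ Yle y M ∧ a⁻¹ * b = α}, (B a)ᴴ * B b) i j =
      ∑ a ∈ (finite_Yle y M).toFinset, ∑ k, star (B a k i) * B (a * α) k j := by
  have hinner (a : Y) :
      ∑ᶠ b ∈ {b : Y | b ∈ Yle y M ∧ a⁻¹ * b = α}, (B a)ᴴ * B b = (B a)ᴴ * B (a * α) := by
    by_cases haα : a * α ∈ Yle y M
    · have : {b : Y | b ∈ Yle y M ∧ a⁻¹ * b = α} = {a * α} := by
        ext b
        simp only [Set.mem_ofPred_eq, Set.mem_singleton_iff, inv_mul_eq_iff_eq_mul]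
        exact ⟨fun hb => hb.2, fun hb => ⟨hb ▸ haα, hb⟩⟩
      rw [this, finsum_mem_singleton]
    · have : {b : Y | b ∈ Yle y M ∧ a⁻¹ * b = α} = ∅ := by
        ext b
        simp only [Set.mem_ofPred_eq, Set.mem_empty_iff_false, inv_mul_eq_iff_eq_mul, iff_false]
        rintro ⟨hb, rfl⟩
        exact haα hb
      rw [this, finsum_mem_empty, not_not.1 (mt (hB _) haα), Matrix.mul_zero]
  simp only [hinner]
  rw [finsum_mem_eq_finite_toFinset_sum _ (finite_Yle y M), Matrix.sum_apply]
  simp [Matrix.mul_apply]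

end Generators

/-- Fejér–Riesz-type factorization on the group `𝔜` under uniform strict positivity. -/
theorem stmt3
    (h K M : ℕ) (hh : 0 < h) (hK : 0 < K) (hM : 0 < M)
    (Y : Type) [Group Y] (y : Fin h → Y)
    (hY : ∀ η : Y, ∃ a b : List (Fin h), ((a.map y).prod)⁻¹ * (b.map y).prod = η)
    (A : Y → Matrix (Fin K) (Fin K) ℂ)
    (hAsupp : ∀ α, A α ≠ 0 → α ∈ HerYle y M)
    (hpos : ∃ ε : ℝ, 0 < ε ∧
      ∀ (F : Type) [NormedAddCommGroup F] [InnerProductSpace ℂ F]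
        [CompleteSpace F] [TopologicalSpace.SeparableSpace F]
        (π : Y →* (F ≃ₗᵢ[ℂ] F)) (ξ : Fin K → F),
        ε * (∑ i : Fin K, ‖ξ i‖ ^ 2) ≤
            (∑ᶠ b ∈ HerYle y M,
              ∑ i : Fin K, ∑ j : Fin K, A b i j * ⟪ξ i, π b (ξ j)⟫).re ∧
        (∑ᶠ b ∈ HerYle y M,
              ∑ i : Fin K, ∑ j : Fin K, A b i j * ⟪ξ i, π b (ξ j)⟫).im = 0) :
    ∃ K' M' : ℕ, 0 < K' ∧ 0 < M' ∧
      ∃ B : Y → Matrix (Fin K') (Fin K) ℂ,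
        ∀ α : Y,
          A α = ∑ᶠ a ∈ Yle y M',
                  ∑ᶠ b ∈ {b : Y | b ∈ Yle y M' ∧ a⁻¹ * b = α},
                    (B a)ᴴ * B b := by
  classical
  obtain ⟨ε, hε, hpos⟩ := hpos
  have := countable_of_left_fractions hY
  set H := (finite_HerYle y M).toFinset
  have hH (α : Y) (hα : α ∉ H) : A α = 0 := by
    by_contra h0
    exact hα ((finite_HerYle y M).mem_toFinset.2 (hAsupp α h0))
  let Φ (φ : ((Y × Fin K × Fin K) →₀ ℂ) →ₗ[ℂ] ℂ) (w z : Fin K → (Y × Fin K) →₀ ℂ) : ℂ :=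
    ∑ b ∈ H, ∑ i, ∑ j, A b i j * φ (hermProd (w i) (leftTranslate Y (Fin K) b (z j)))
  have hΦ (φ : ((Y × Fin K × Fin K) →₀ ℂ) →ₗ[ℂ] ℂ) (hφ : ∀ u, 0 ≤ (φ (hermProd u u)).re)
      (hφs : ∀ f, φ (hermStar f) = star (φ f)) (w : Fin K → (Y × Fin K) →₀ ℂ) :
      ε * ∑ i, (φ (hermProd (w i) (w i))).re ≤ (Φ φ w w).re ∧ (Φ φ w w).im = 0 := by
    obtain ⟨F, _, _, _, _, π, Λ, hΛ, hπ⟩ := exists_unitaryRep_of_functional φ hφ hφs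
    have hF := hpos F π fun i => Λ (w i)
    simp only [hπ, hΛ, @norm_sq_eq_re_inner ℂ F] at hF
    rwa [finsum_mem_eq_finite_toFinset_sum _ (finite_HerYle y M)] at hF
  let f : (Y × Fin K × Fin K) →₀ ℂ := ∑ b ∈ H, ∑ i, ∑ j, Finsupp.single (b, i, j) (A b i j)
  have hf (α : Y) (i j : Fin K) : f (α, i, j) = A α i j := by
    have h1 : f (α, i, j) = ∑ b ∈ H, if b = α then A b i j else 0 := by
      simp only [f, Finsupp.finsetSum_apply]
      refine Finset.sum_congr rfl fun b _ => ?_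
      rw [Finset.sum_eq_single i, Finset.sum_eq_single j] <;>
        simp +contextual [Finsupp.single_apply]
    rw [h1, Finset.sum_ite_eq' H α]
    split_ifs with hα
    · rfl
    · rw [hH α hα]; rfl
  have hstar : hermStar f = f := by
    let k₀ : Fin K := ⟨0, hK⟩
    let φ : ((Y × Fin K × Fin K) →₀ ℂ) →ₗ[ℂ] ℂ := Finsupp.lapply (1, k₀, k₀)
    have hφ (u) : 0 ≤ (φ (hermProd u u)).re := by
      simp only [φ, Finsupp.lapply_apply]
      rw [hermProd_apply u u (u.support.image Prod.fst)
        (fun a i h0 => Finset.mem_image.2 ⟨(a, i), by simpa using h0, rfl⟩), Complex.re_sum]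
      refine Finset.sum_nonneg fun a _ => ?_
      rw [mul_one, Complex.star_def, ← Complex.normSq_eq_conj_mul_self, Complex.ofReal_re]
      exact Complex.normSq_nonneg _
    have hφs (x) : φ (hermStar x) = star (φ x) := by
      simp [φ, hermStar_apply]
    have hsymm := eq_star_of_im_self_eq_zero (Φ φ)
      (fun x y z => by simp [Φ, mul_add, Finset.sum_add_distrib])
      (fun x y z => by simp [Φ, mul_add, Finset.sum_add_distrib])
      (fun x y => by simp [Φ, Finset.mul_sum, mul_left_comm])
      (fun x y => by simp [Φ, Finset.mul_sum, mul_left_comm])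
      (fun x => (hΦ φ hφ hφs x).2)
    have hcoef (a c : Y) (p q : Fin K) :
        Φ φ (Pi.single p (Finsupp.single (a, k₀) 1)) (Pi.single q (Finsupp.single (c, k₀) 1)) =
          A (a * c⁻¹) p q := by
      have h1 (b : Y) : (∑ i, ∑ j, A b i j * φ (hermProd
          ((Pi.single p (Finsupp.single (a, k₀) 1) : Fin K → (Y × Fin K) →₀ ℂ) i)
          (leftTranslate Y (Fin K) b
            ((Pi.single q (Finsupp.single (c, k₀) 1) : Fin K → (Y × Fin K) →₀ ℂ) j)))) =
          if b = a * c⁻¹ then A b p q else 0 := by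
        rw [Finset.sum_eq_single p, Finset.sum_eq_single q]
        · simp [φ, leftTranslate_single, hermProd_single, Finsupp.single_apply,
            inv_mul_eq_one, eq_mul_inv_iff_mul_eq, eq_comm]
        all_goals simp +contextual
      simp only [Φ, h1]
      rw [Finset.sum_ite_eq' H]
      split_ifs with hα
      · rfl
      · rw [hH _ hα]; rfl
    ext ⟨g, p, q⟩
    rw [hermStar_apply, hf, hf]
    have := hsymm (Pi.single p (Finsupp.single (g, k₀) 1)) (Pi.single q (Finsupp.single (1, k₀) 1))
    rw [hcoef, hcoef] at this
    simpa using this.symm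
  have hmem : f ∈ sosReCone Y (Fin K) := by
    by_contra hmem
    obtain ⟨φ, hφ, hφs, hφ1, hφf⟩ := exists_functional_of_notMem hmem
    have h1 := (hΦ φ hφ hφs fun i => Finsupp.single (1, i) 1).1
    have h2 : ∑ i, (φ (hermProd (Finsupp.single ((1 : Y), i) 1)
        (Finsupp.single (1, i) 1))).re = 1 := by
      rw [← hφ1, hermOne, map_sum, Complex.re_sum]
      simp [hermProd_single]
    have h3 : Φ φ (fun i => Finsupp.single (1, i) 1) (fun i => Finsupp.single (1, i) 1) =
        φ f := by
      simp only [Φ, f, map_sum, leftTranslate_single, hermProd_single]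
      refine Finset.sum_congr rfl fun b _ => Finset.sum_congr rfl fun i _ =>
        Finset.sum_congr rfl fun j _ => ?_
      rw [← smul_eq_mul, ← map_smul]
      simp
    rw [h2, h3] at h1
    linarith
  rw [mem_sosReCone, hstar] at hmem
  have hsos : f ∈ sosCone Y (Fin K) := by
    convert PointedCone.smul_mem _ (by norm_num : (0 : ℝ) ≤ 2⁻¹) hmem using 1
    module
  obtain ⟨n, u, hu⟩ := exists_eq_sum_hermProd hsos
  obtain ⟨g, M', hM', hg⟩ :=
    exists_mul_mem_Yle hY (Finset.univ.biUnion fun k => (u k).support.image Prod.fst)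
  let v (k : Fin (n + 1)) := leftTranslate Y (Fin K) g (u k)
  have hv (k : Fin (n + 1)) (a : Y) (i : Fin K) (hne : v k (a, i) ≠ 0) : a ∈ Yle y M' := by
    rw [leftTranslate_apply] at hne
    have := hg (g⁻¹ * a) (Finset.mem_biUnion.2 ⟨k, Finset.mem_univ k,
      Finset.mem_image.2 ⟨(g⁻¹ * a, i), by simpa using hne, rfl⟩⟩)
    rwa [mul_inv_cancel_left] at this
  refine ⟨n + 1, M', n.succ_pos, hM', fun a => Matrix.of fun k i => v k (a, i), fun α => ?_⟩
  ext i j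
  rw [finsum_factorization_apply, ← hf, hu, Finsupp.finsetSum_apply, Finset.sum_comm]
  · refine Finset.sum_congr rfl fun k _ => ?_
    rw [← hermProd_leftTranslate g, hermProd_apply _ _ (finite_Yle y M').toFinset
      fun a i hne => (finite_Yle y M').mem_toFinset.2 (hv k a i hne)]
    rfl
  · intro a ha
    by_contra hnot
    apply ha
    ext k i
    by_contra hne
    exact hnot (hv k a i hne)
end

section
/- Let G be a countable group, n a positive integer, and A : G → M_n(ℂ) a finitely supported function. Suppose that for every complex Hilbert space K and every unitary representation π of G on K, the operator A(π) on K^n is positive definite, i.e., ⟨A(π)ξ, ξ⟩ > 0 for every nonzero ξ ∈ K^n. Then there exists ε > 0 such that for every complex Hilbert space K and every unitary representation π of G on K, ⟨A(π)ξ, ξ⟩ ≥ ε‖ξ‖² for all ξ ∈ K^n. -/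
open scoped ComplexInnerProductSpace
open Matrix

universe u v

/-- A linear isometric automorphism of a seminormed space extends to its completion. -/
noncomputable def LinearIsometryEquiv.completionMap {E : Type u} [SeminormedAddCommGroup E]
    [InnerProductSpace ℂ E] (e : E ≃ₗᵢ[ℂ] E) :
    UniformSpace.Completion E ≃ₗᵢ[ℂ] UniformSpace.Completion E where
  toFun := UniformSpace.Completion.map e
  invFun := UniformSpace.Completion.map e.symm
  map_add' x y := by
    induction x, y using UniformSpace.Completion.induction_on₂ with
    | hp => apply isClosed_eq <;> fun_prop (disch := exact UniformSpace.Completion.continuous_map)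
    | ih x y =>
      simp only [← UniformSpace.Completion.coe_add,
        UniformSpace.Completion.map_coe e.isometry.uniformContinuous, map_add]
  map_smul' c x := by
    induction x using UniformSpace.Completion.induction_on with
    | hp =>
      exact isClosed_eq (UniformSpace.Completion.continuous_map.comp (continuous_const_smul c))
        ((UniformSpace.Completion.continuous_map (f := e)).const_smul c)
    | ih x =>
      simp only [← UniformSpace.Completion.coe_smul, RingHom.id_apply,
        UniformSpace.Completion.map_coe e.isometry.uniformContinuous, map_smul]
  left_inv x := by
    rw [← Function.comp_apply (f := UniformSpace.Completion.map e.symm),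
      UniformSpace.Completion.map_comp e.symm.isometry.uniformContinuous
      e.isometry.uniformContinuous]
    simp [Function.comp_def, ← Function.id_def]
  right_inv x := by
    rw [← Function.comp_apply (f := UniformSpace.Completion.map e),
      UniformSpace.Completion.map_comp e.isometry.uniformContinuous
      e.symm.isometry.uniformContinuous]
    simp [Function.comp_def, ← Function.id_def]
  norm_map' x := by
    change ‖UniformSpace.Completion.map e x‖ = ‖x‖
    induction x using UniformSpace.Completion.induction_on with
    | hp => exact isClosed_eq UniformSpace.Completion.continuous_map.norm continuous_norm
    | ih x => simp [UniformSpace.Completion.map_coe e.isometry.uniformContinuous]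

theorem LinearIsometryEquiv.completionMap_coe {E : Type u} [SeminormedAddCommGroup E]
    [InnerProductSpace ℂ E] (e : E ≃ₗᵢ[ℂ] E) (x : E) :
    e.completionMap (x : UniformSpace.Completion E) = (e x : E) :=
  UniformSpace.Completion.map_coe e.isometry.uniformContinuous x

theorem LinearIsometryEquiv.completionMap_mul {E : Type u} [SeminormedAddCommGroup E]
    [InnerProductSpace ℂ E] (e f : E ≃ₗᵢ[ℂ] E) :
    (e * f).completionMap = e.completionMap * f.completionMap := by
  ext x
  induction x using UniformSpace.Completion.induction_on with
  | hp => exact isClosed_eq (LinearIsometryEquiv.continuous _) (LinearIsometryEquiv.continuous _)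
  | ih x => simp [completionMap_coe]

/-- A linear action preserving a positive semidefinite sesquilinear form induces a unitary
representation on the associated Hilbert space. -/
theorem exists_unitaryRep_of_preInner {G : Type v} [Group G] {E : Type u} [AddCommGroup E]
    [Module ℂ E] (c : PreInnerProductSpace.Core ℂ E) (ρ : Representation ℂ G E)
    (h : ∀ g x y, c.inner (ρ g x) (ρ g y) = c.inner x y) :
    ∃ (K : Type u) (_ : NormedAddCommGroup K) (_ : InnerProductSpace ℂ K) (_ : CompleteSpace K)
      (π : G →* (K ≃ₗᵢ[ℂ] K)) (ι : E → K),
      (∀ x y, ⟪ι x, ι y⟫ = c.inner x y) ∧ ∀ g x, π g (ι x) = ι (ρ g x) := by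
  let : SeminormedAddCommGroup E := InnerProductSpace.Core.toSeminormedAddCommGroup (𝕜 := ℂ)
  let : InnerProductSpace ℂ E := .ofCore c
  let U (g : G) : E ≃ₗᵢ[ℂ] E :=
    { toLinearEquiv := .ofLinearMap (ρ g) (ρ g⁻¹)
        (by ext x; simp [← Module.End.mul_apply, ← map_mul])
        (by ext x; simp [← Module.End.mul_apply, ← map_mul])
      norm_map' := fun x => by
        rw [@norm_eq_sqrt_re_inner ℂ, @norm_eq_sqrt_re_inner ℂ]
        exact congrArg (fun z : ℂ => √(RCLike.re z)) (h g x x) }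
  refine ⟨UniformSpace.Completion E, inferInstance, inferInstance, inferInstance,
    MonoidHom.mk' (fun g => (U g).completionMap) fun g k => ?_, fun x => x, ?_, ?_⟩
  · rw [← LinearIsometryEquiv.completionMap_mul]
    congr 1
    ext x
    exact DFunLike.congr_fun (map_mul ρ g k) x
  · intro x y
    exact UniformSpace.Completion.inner_coe x y
  · intro g x
    exact LinearIsometryEquiv.completionMap_coe _ _

open scoped ComplexOrder in
/-- A positive semidefinite kernel invariant under a group action is the Gram matrix of
a family of vectors permuted by a unitary representation. -/
theorem Matrix.PosSemidef.exists_unitaryRep {G : Type v} [Group G] {X : Type u} [MulAction G X]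
    {M : Matrix X X ℂ} (hM : M.PosSemidef) (hinv : ∀ (g : G) x y, M (g • x) (g • y) = M x y) :
    ∃ (K : Type u) (_ : NormedAddCommGroup K) (_ : InnerProductSpace ℂ K) (_ : CompleteSpace K)
      (π : G →* (K ≃ₗᵢ[ℂ] K)) (v : X → K),
      (∀ x y, ⟪v x, v y⟫ = M x y) ∧ ∀ g x, π g (v x) = v (g • x) := by
  let c : PreInnerProductSpace.Core ℂ (X →₀ ℂ) :=
    { inner := fun f g => f.sum fun x z => g.sum fun y w => star z * M x y * w
      conj_inner_symm := fun f g => by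
        rw [Finsupp.sum_comm]
        simp only [map_finsuppSum]
        refine Finsupp.sum_congr fun x _ => Finsupp.sum_congr fun y _ => ?_
        rw [← hM.isHermitian.apply x y]
        simp [mul_comm, mul_left_comm]
      add_left := fun _ _ _ => by
        rw [Finsupp.sum_add_index'] <;> simp [← Finsupp.sum_add, add_mul]
      smul_left := fun _ _ _ => by
        rw [Finsupp.sum_smul_index] <;> simp [Finsupp.mul_sum, ← mul_assoc]
      re_inner_nonneg := fun f => (Complex.nonneg_iff.1 (hM.2 f)).1 }
  let ρ : Representation ℂ G (X →₀ ℂ) :=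
    { toFun := fun g => Finsupp.lmapDomain ℂ ℂ (g • ·)
      map_one' := by ext; simp
      map_mul' := fun g k => by ext; simp [mul_smul] }
  obtain ⟨K, i₁, i₂, i₃, π, ι, hι, hπ⟩ := exists_unitaryRep_of_preInner c ρ fun g f k => by
    change (Finsupp.mapDomain (g • ·) f).sum (fun x z =>
      (Finsupp.mapDomain (g • ·) k).sum fun y w => star z * M x y * w) =
      f.sum fun x z => k.sum fun y w => star z * M x y * w
    rw [Finsupp.sum_mapDomain_index_inj (MulAction.injective g)]
    simp_rw [Finsupp.sum_mapDomain_index_inj (MulAction.injective g), hinv]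
  refine ⟨K, i₁, i₂, i₃, π, fun x => ι (Finsupp.single x 1), fun x y => ?_, fun g x => ?_⟩
  · rw [hι]
    change ((Finsupp.single x (1 : ℂ)).sum fun x z =>
      (Finsupp.single y (1 : ℂ)).sum fun y w => star z * M x y * w) = M x y
    simp
  · simp [hπ, ρ]

open scoped ComplexOrder in
/-- Gram matrices of arbitrary families are positive semidefinite. -/
theorem Matrix.posSemidef_of_inner {X : Type u} {K : Type v} [NormedAddCommGroup K]
    [InnerProductSpace ℂ K] (v : X → K) :
    (Matrix.of fun x y => ⟪v x, v y⟫ : Matrix X X ℂ).PosSemidef := by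
  refine ⟨Matrix.IsHermitian.ext fun x y => by simp, fun f => ?_⟩
  have : (f.sum fun x z => f.sum fun y w => star z * ⟪v x, v y⟫ * w) =
      ⟪f.sum fun x z => z • v x, f.sum fun x z => z • v x⟫ := by
    simp only [Finsupp.sum, sum_inner]
    simp only [inner_sum, inner_smul_left, inner_smul_right]
    refine Finset.sum_congr rfl fun x _ => Finset.sum_congr rfl fun y _ => ?_
    simp [mul_comm, mul_left_comm]
  simp only [Matrix.of_apply, this]
  rw [inner_self_eq_norm_sq_to_K, ← RCLike.ofReal_pow]
  exact RCLike.ofReal_nonneg.2 (sq_nonneg _)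

open scoped ComplexOrder in
theorem Matrix.isClosed_setOf_posSemidef {X : Type u} :
    IsClosed {M : Matrix X X ℂ | M.PosSemidef} := by
  simp only [Matrix.PosSemidef, Set.ofPred_and, Set.ofPred_forall]
  refine IsClosed.inter ?_ (isClosed_iInter fun f => isClosed_le continuous_const ?_)
  · exact isClosed_eq continuous_id.matrix_conjTranspose continuous_id
  · simp only [Finsupp.sum]
    fun_prop

open scoped ComplexOrder in
/-- The `G`-invariant positive semidefinite kernels on `X` with entries in the unit disc whose
diagonal sums to one along the finite set `s`. -/
def normalizedKernels (G : Type v) [Group G] {X : Type u} [MulAction G X] (s : Finset X) :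
    Set (Matrix X X ℂ) :=
  {M | M.PosSemidef} ∩ {M | ∀ (g : G) x y, M (g • x) (g • y) = M x y} ∩
    {M | ∑ x ∈ s, M x x = 1} ∩ {M | ∀ x y, M x y ∈ Metric.closedBall (0 : ℂ) 1}

theorem isCompact_normalizedKernels (G : Type v) [Group G] {X : Type u} [MulAction G X]
    (s : Finset X) : IsCompact (normalizedKernels G s) := by
  refine IsCompact.inter_left ?_ (.inter (.inter Matrix.isClosed_setOf_posSemidef ?_) ?_)
  · convert! isCompact_univ_pi fun _ : X => isCompact_univ_pi fun _ : X =>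
      isCompact_closedBall (0 : ℂ) 1
    ext M
    exact ⟨fun h x _ y _ => h x y, fun h x y => h x trivial y trivial⟩
  · simp only [Set.ofPred_forall]
    exact isClosed_iInter fun g => isClosed_iInter fun x => isClosed_iInter fun y =>
      isClosed_eq (by fun_prop) (by fun_prop)
  · exact isClosed_eq (by fun_prop) continuous_const

/-- From positive definite to uniformly bounded below: for a finitely supported
matrix-valued function on a countable group, strict positivity of `A(π)` for every
unitary representation `π` implies a uniform lower bound `ε`. -/
theorem stmt4
    (G : Type) [Group G] [Countable G] (n : ℕ) (hn : 0 < n)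
    (A : G → Matrix (Fin n) (Fin n) ℂ)
    (hsupp : (Function.support A).Finite)
    (hpos : ∀ (K : Type) [NormedAddCommGroup K] [InnerProductSpace ℂ K]
        [CompleteSpace K] (π : G →* (K ≃ₗᵢ[ℂ] K)) (ξ : Fin n → K), ξ ≠ 0 →
        0 < (∑ᶠ a : G, ∑ i : Fin n, ∑ j : Fin n, A a i j * ⟪ξ i, π a (ξ j)⟫).re ∧
        (∑ᶠ a : G, ∑ i : Fin n, ∑ j : Fin n, A a i j * ⟪ξ i, π a (ξ j)⟫).im = 0) :
    ∃ ε : ℝ, 0 < ε ∧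
      ∀ (K : Type) [NormedAddCommGroup K] [InnerProductSpace ℂ K]
        [CompleteSpace K] (π : G →* (K ≃ₗᵢ[ℂ] K)) (ξ : Fin n → K),
        ε * (∑ i : Fin n, ‖ξ i‖ ^ 2) ≤
            (∑ᶠ a : G, ∑ i : Fin n, ∑ j : Fin n, A a i j * ⟪ξ i, π a (ξ j)⟫).re ∧
        (∑ᶠ a : G, ∑ i : Fin n, ∑ j : Fin n, A a i j * ⟪ξ i, π a (ξ j)⟫).im = 0 := by
  let : MulAction G (G × Fin n) :=
    { smul := fun g x => (g * x.1, x.2)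
      one_smul := fun x => Prod.ext (one_mul _) rfl
      mul_smul := fun g k x => Prod.ext (mul_assoc _ _ _) rfl }
  let F (M : Matrix (G × Fin n) (G × Fin n) ℂ) : ℂ :=
    ∑ a ∈ hsupp.toFinset, ∑ i, ∑ j, A a i j * M (1, i) (a, j)
  have hF (f : G → Fin n → Fin n → ℂ) :
      ∑ᶠ a : G, ∑ i, ∑ j, A a i j * f a i j =
        ∑ a ∈ hsupp.toFinset, ∑ i, ∑ j, A a i j * f a i j := by
    refine finsum_eq_sum_of_support_subset _ fun a ha => ?_
    contrapose! ha
    have : A a = 0 := by simpa using ha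
    simp [this]
  let s : Finset (G × Fin n) :=
    Finset.univ.map ⟨fun i => (1, i), fun _ _ h => congrArg Prod.snd h⟩
  have hs (f : G × Fin n → ℂ) : ∑ x ∈ s, f x = ∑ i, f (1, i) := Finset.sum_map _ _ _
  have hFpos : ∀ M ∈ normalizedKernels G s, 0 < (F M).re := by
    rintro M ⟨⟨⟨hM, hinv⟩, htr⟩, -⟩
    obtain ⟨K, _, _, _, π, v, hv, hπ⟩ := hM.exists_unitaryRep hinv
    have hne : (fun i => v (1, i)) ≠ 0 := by
      intro h0
      have h0' (i : Fin n) : v (1, i) = 0 := congrFun h0 i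
      simp [hs, ← hv, h0'] at htr
    have hsmul (a : G) (j : Fin n) : a • ((1, j) : G × Fin n) = (a, j) :=
      Prod.ext (mul_one a) rfl
    have h := (hpos K π _ hne).1
    simp only [hπ, hsmul, hv] at h
    rwa [hF] at h
  obtain ⟨ε, hε, hle⟩ :=
    (isCompact_normalizedKernels G s).exists_forall_le' (f := fun M => (F M).re)
      (by simp only [F]; fun_prop) hFpos
  refine ⟨ε, hε, fun K _ _ _ π ξ => ?_⟩
  by_cases hξ : ξ = 0
  · simp [hξ]
  refine ⟨?_, (hpos K π ξ hξ).2⟩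
  set S := ∑ i, ‖ξ i‖ ^ 2
  have hSpos : 0 < S := by
    obtain ⟨i, hi⟩ := Function.ne_iff.1 hξ
    exact Finset.sum_pos' (fun _ _ => by positivity)
      ⟨i, Finset.mem_univ i, by have := norm_pos_iff.2 hi; positivity⟩
  have hc : (((√S)⁻¹ : ℝ) : ℂ) * ((√S)⁻¹ : ℝ) = (S⁻¹ : ℝ) := by
    rw [← Complex.ofReal_mul, ← mul_inv, Real.mul_self_sqrt hSpos.le]
  let v (x : G × Fin n) : K := (((√S)⁻¹ : ℝ) : ℂ) • π x.1 (ξ x.2)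
  have hv (x y) : ⟪v x, v y⟫ = (S⁻¹ : ℝ) * ⟪π x.1 (ξ x.2), π y.1 (ξ y.2)⟫ := by
    rw [inner_smul_left, inner_smul_right, Complex.conj_ofReal, ← mul_assoc, hc]
  have hnorm (x) : ‖v x‖ ≤ 1 := by
    rw [norm_smul, LinearIsometryEquiv.norm_map, Complex.norm_real,
      Real.norm_of_nonneg (by positivity), inv_mul_le_one₀ (by positivity)]
    exact Real.le_sqrt_of_sq_le (Finset.single_le_sum (f := fun i => ‖ξ i‖ ^ 2)
      (fun _ _ => by positivity) (Finset.mem_univ x.2))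
  have hmem : (Matrix.of fun x y => ⟪v x, v y⟫) ∈ normalizedKernels G s := by
    refine ⟨⟨⟨Matrix.posSemidef_of_inner v, fun g x y => ?_⟩, ?_⟩, fun x y => ?_⟩
    · change ⟪v (g * x.1, x.2), v (g * y.1, y.2)⟫ = ⟪v x, v y⟫
      simp [hv]
    · have hself (i : Fin n) : ⟪ξ i, ξ i⟫ = ((‖ξ i‖ ^ 2 : ℝ) : ℂ) :=
        (inner_self_eq_norm_sq_to_K _).trans (Complex.ofReal_pow _ _).symm
      change ∑ x ∈ s, ⟪v x, v x⟫ = 1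
      simp only [hs, hv, map_one, LinearIsometryEquiv.coe_one, id_eq, ← Finset.mul_sum, hself]
      rw [← Complex.ofReal_sum, ← Complex.ofReal_mul, inv_mul_cancel₀ hSpos.ne',
        Complex.ofReal_one]
    · rw [mem_closedBall_zero_iff]
      exact (norm_inner_le_norm _ _).trans (mul_le_one₀ (hnorm x) (norm_nonneg _) (hnorm y))
  have h := hle _ hmem
  have hFv : F (Matrix.of fun x y => ⟪v x, v y⟫) = (S⁻¹ : ℝ) *
      ∑ᶠ a : G, ∑ i : Fin n, ∑ j : Fin n, A a i j * ⟪ξ i, π a (ξ j)⟫ := by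
    rw [hF]
    simp [F, hv, Finset.mul_sum, mul_left_comm]
  simp only [hFv, Complex.re_ofReal_mul] at h
  rwa [le_inv_mul_iff₀ hSpos, mul_comm] at h
end

section
/- Let A be a unital C*-algebra, n a positive integer, L a complex Hilbert space, and ρ : Mₙ(A) → B(L) a unital *-homomorphism, where Mₙ(A) denotes the n×n matrices with entries in A (with matrix multiplication and conjugate-transpose star). Then there exist a complex Hilbert space L₀, a unital *-homomorphism σ : A → B(L₀), and a unitary operator U : L → L₀ⁿ (the n-fold Hilbert direct sum) such that for every X ∈ Mₙ(ℂ) and a ∈ A, the operator U ρ(X·a) U⁻¹ on L₀ⁿ sends ξ to the vector with i-th component Σ_j X_{ij} σ(a) ξ_j, where X·a ∈ Mₙ(A) is the matrix whose (i,j) entry is X_{ij} a. -/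
/-- A bundled complex Hilbert space. -/
structure HilbertC : Type 1 where
  carrier : Type
  [nacg : NormedAddCommGroup carrier]
  [ips : InnerProductSpace ℂ carrier]
  [complete : CompleteSpace carrier]

attribute [instance] HilbertC.nacg HilbertC.ips HilbertC.complete

open Matrix in
/-- The range of the projection `ρ (single k k 1)`, as a closed subspace. -/
noncomputable abbrev cornerSpace {A L ι : Type*} [Fintype ι] [DecidableEq ι]
    [Ring A] [StarRing A] [Algebra ℂ A]
    [NormedAddCommGroup L] [InnerProductSpace ℂ L] [CompleteSpace L]
    (ρ : Matrix ι ι A →⋆ₐ[ℂ] (L →L[ℂ] L)) (k : ι) : Submodule ℂ L :=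
  (ρ (single k k 1) - 1 : L →L[ℂ] L).ker

namespace cornerSpace

open Matrix

variable {A L ι : Type*} [Fintype ι] [DecidableEq ι] [Ring A] [StarRing A] [Algebra ℂ A]
  [NormedAddCommGroup L] [InnerProductSpace ℂ L] [CompleteSpace L]
  (ρ : Matrix ι ι A →⋆ₐ[ℂ] (L →L[ℂ] L)) (k : ι)

theorem mem_iff {x : L} : x ∈ cornerSpace ρ k ↔ ρ (single k k 1) x = x := by
  simp [cornerSpace, sub_eq_zero]

theorem map_apply_map_apply (M N : Matrix ι ι A) (x : L) : ρ M (ρ N x) = ρ (M * N) x := by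
  rw [map_mul]; rfl

theorem map_single_mem (i : ι) (a : A) (x : L) : ρ (single k i a) x ∈ cornerSpace ρ k := by
  rw [mem_iff, map_apply_map_apply, single_mul_single_same, one_mul]

theorem map_single_one_apply (x : cornerSpace ρ k) : ρ (single k k 1) (x : L) = x :=
  (mem_iff ρ k).1 x.2

theorem inner_map_left (M : Matrix ι ι A) (x y : L) :
    inner ℂ (ρ M x) y = inner ℂ x (ρ Mᴴ y) := by
  rw [← star_eq_conjTranspose, map_star, ContinuousLinearMap.star_eq_adjoint,
    ContinuousLinearMap.adjoint_inner_right]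

/-- The restriction of `ρ (single k k a)` to the corner space. -/
noncomputable def cornerMap (a : A) : cornerSpace ρ k →L[ℂ] cornerSpace ρ k :=
  (ρ (single k k a) ∘L (cornerSpace ρ k).subtypeL).codRestrict _
    fun x => by
      simpa only [ContinuousLinearMap.comp_apply, Submodule.subtypeL_apply] using
        map_single_mem ρ k k a (x : L)

theorem coe_cornerMap_apply (a : A) (x : cornerSpace ρ k) :
    (cornerMap ρ k a x : L) = ρ (single k k a) x := rfl

/-- The action of `A` on the corner space through `a ↦ ρ (single k k a)`. -/
noncomputable def corner : A →⋆ₐ[ℂ] (cornerSpace ρ k →L[ℂ] cornerSpace ρ k) where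
  toFun := cornerMap ρ k
  map_one' := by
    ext x
    exact map_single_one_apply ρ k x
  map_mul' a b := by
    ext x
    change _ = (cornerMap ρ k a (cornerMap ρ k b x) : L)
    rw [coe_cornerMap_apply, coe_cornerMap_apply, coe_cornerMap_apply, map_apply_map_apply,
      single_mul_single_same]
  map_zero' := by
    ext x
    simp [coe_cornerMap_apply]
  map_add' a b := by
    ext x
    simp [coe_cornerMap_apply, single_add]
  commutes' r := by
    ext x
    have h : single k k (algebraMap ℂ A r) = r • single k k (1 : A) := by
      rw [smul_single, Algebra.algebraMap_eq_smul_one]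
    rw [coe_cornerMap_apply, h, map_smul, _root_.smul_apply, map_single_one_apply]
    rfl
  map_star' a := by
    rw [ContinuousLinearMap.star_eq_adjoint, ContinuousLinearMap.eq_adjoint_iff]
    intro x y
    rw [Submodule.coe_inner, Submodule.coe_inner, coe_cornerMap_apply, coe_cornerMap_apply,
      inner_map_left, conjTranspose_single, star_star]

@[simp]
theorem coe_corner_apply (a : A) (x : cornerSpace ρ k) :
    (corner ρ k a x : L) = ρ (single k k a) x := rfl

theorem sum_map_single_apply (x : L) : ∑ i, ρ (single i i 1) x = x := by
  rw [← _root_.sum_apply, ← map_sum, sum_single_one, map_one]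
  rfl

/-- The Hilbert space is the direct sum of `ι` copies of the corner space. -/
noncomputable def decomposition : L ≃ₗᵢ[ℂ] PiLp 2 (fun _ : ι => cornerSpace ρ k) where
  toFun x := WithLp.toLp 2 fun i => ⟨ρ (single k i 1) x, map_single_mem ρ k i 1 x⟩
  invFun ξ := ∑ i, ρ (single i k 1) (ξ i)
  map_add' x y := by
    ext i
    simp
  map_smul' r x := by
    ext i
    simp
  left_inv x := by
    simp [map_apply_map_apply, sum_map_single_apply]
  right_inv ξ := by
    ext i
    simp only [map_sum]
    rw [Finset.sum_eq_single i]
    · rw [map_apply_map_apply, single_mul_single_same, one_mul, map_single_one_apply]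
    · intro j _ hj
      rw [map_apply_map_apply, single_mul_single_of_ne (h := hj.symm), map_zero, _root_.zero_apply]
    · simp
  norm_map' x := by
    have h : ∀ i, ‖ρ (single k i 1) x‖ ^ 2 = RCLike.re (inner ℂ x (ρ (single i i 1) x)) := by
      intro i
      rw [← inner_self_eq_norm_sq (𝕜 := ℂ), inner_map_left, map_apply_map_apply, conjTranspose_single,
        star_one, single_mul_single_same, one_mul]
    rw [← sq_eq_sq₀ (norm_nonneg _) (norm_nonneg _), PiLp.norm_sq_eq_of_L2]
    calc ∑ i, ‖ρ (single k i 1) x‖ ^ 2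
        = RCLike.re (inner ℂ x (∑ i, ρ (single i i 1) x)) := by
          simp only [h, inner_sum, map_sum]
      _ = ‖x‖ ^ 2 := by rw [sum_map_single_apply, inner_self_eq_norm_sq]

@[simp]
theorem coe_decomposition_apply (x : L) (i : ι) :
    (decomposition ρ k x i : L) = ρ (single k i 1) x := rfl

theorem decomposition_symm_apply (ξ : PiLp 2 (fun _ : ι => cornerSpace ρ k)) :
    (decomposition ρ k).symm ξ = ∑ i, ρ (single i k 1) (ξ i) := rfl

theorem decomposition_conj_apply (M : Matrix ι ι A)
    (ξ : PiLp 2 (fun _ : ι => cornerSpace ρ k)) (i : ι) :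
    decomposition ρ k (ρ M ((decomposition ρ k).symm ξ)) i = ∑ j, corner ρ k (M i j) (ξ j) := by
  ext
  rw [coe_decomposition_apply, decomposition_symm_apply]
  simp only [map_sum, map_apply_map_apply, Submodule.coe_sum, coe_corner_apply]
  simp only [← mul_assoc, single_mul_mul_single, one_mul, mul_one]

end cornerSpace

/-- Every representation of `Mₙ(A)` is unitarily equivalent to one of the form
`X ⊗ a ↦ X ⊗ σ(a)`. -/
theorem stmt5
    (A : Type) [NormedRing A] [StarRing A] [CStarRing A] [NormedAlgebra ℂ A]
    [CompleteSpace A] [StarModule ℂ A]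
    (n : ℕ) (hn : 0 < n)
    (L : Type) [NormedAddCommGroup L] [InnerProductSpace ℂ L] [CompleteSpace L]
    (ρ : Matrix (Fin n) (Fin n) A →⋆ₐ[ℂ] (L →L[ℂ] L)) :
    ∃ L₀ : HilbertC, ∃ σ : A →⋆ₐ[ℂ] (L₀.carrier →L[ℂ] L₀.carrier),
      ∃ U : L ≃ₗᵢ[ℂ] PiLp 2 (fun _ : Fin n => L₀.carrier),
        ∀ (X : Matrix (Fin n) (Fin n) ℂ) (a : A)
          (ξ : PiLp 2 fun _ : Fin n => L₀.carrier) (i : Fin n),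
          (U (ρ (X.map fun c => c • a) (U.symm ξ))) i = ∑ j : Fin n, X i j • σ a (ξ j) := by
  refine ⟨⟨cornerSpace ρ ⟨0, hn⟩⟩, cornerSpace.corner ρ _, cornerSpace.decomposition ρ _,
    fun X a ξ i => ?_⟩
  rw [cornerSpace.decomposition_conj_apply]
  simp
end

section
/- Let G be a group, E a complex Hilbert space, and N a positive integer. Suppose functions p_{j,k} : G → B(E) are given for all pairs (j,k) ∈ {0,1,…,N}² except (0,N) and (N,0), satisfying p_{k,j}(g) = (p_{j,k}(g⁻¹))* for all such pairs and all g ∈ G. Assume that the families (p_{j,k}) indexed by {0,1,…,N−1}² and by {1,…,N}² are both positive semidefinite, and that the families (p_{0,0}), (p_{j,k})_{1≤j,k≤N−1}, and (p_{N,N}) are positive definite. Then there exists a function p : G → B(E) such that, setting p_{0,N} = p and p_{N,0}(g) = (p(g⁻¹))*, the full family (p_{j,k}) indexed by {0,1,…,N}² is positive semidefinite. -/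
open scoped ComplexInnerProductSpace

/-- A family of functions `p j k : G → B(E)`, indexed by a set `J`, is positive
semidefinite: for all finitely supported `φ_j : G → E` the associated form is
real and nonnegative. -/
def IsPSDFamily {ι : Type*} {G : Type*} [Group G] {E : Type*}
    [NormedAddCommGroup E] [InnerProductSpace ℂ E]
    (J : Set ι) (p : ι → ι → G → (E →L[ℂ] E)) : Prop :=
  ∀ φ : ι → G →₀ E,
    0 ≤ (∑ᶠ j ∈ J, ∑ᶠ k ∈ J, ∑ᶠ g : G, ∑ᶠ h : G,
          ⟪φ j g, p j k (g⁻¹ * h) (φ k h)⟫).re ∧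
    (∑ᶠ j ∈ J, ∑ᶠ k ∈ J, ∑ᶠ g : G, ∑ᶠ h : G,
          ⟪φ j g, p j k (g⁻¹ * h) (φ k h)⟫).im = 0

/-- A family of functions `p j k : G → B(E)`, indexed by a set `J`, is positive
definite: moreover the form is strictly positive whenever some `φ_j`, `j ∈ J`,
is nonzero. -/
def IsPDFamily {ι : Type*} {G : Type*} [Group G] {E : Type*}
    [NormedAddCommGroup E] [InnerProductSpace ℂ E]
    (J : Set ι) (p : ι → ι → G → (E →L[ℂ] E)) : Prop :=
  ∀ φ : ι → G →₀ E, (∃ j ∈ J, φ j ≠ 0) →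
    0 < (∑ᶠ j ∈ J, ∑ᶠ k ∈ J, ∑ᶠ g : G, ∑ᶠ h : G,
          ⟪φ j g, p j k (g⁻¹ * h) (φ k h)⟫).re ∧
    (∑ᶠ j ∈ J, ∑ᶠ k ∈ J, ∑ᶠ g : G, ∑ᶠ h : G,
          ⟪φ j g, p j k (g⁻¹ * h) (φ k h)⟫).im = 0

/-- The form of a finite family of operator-valued functions on a group, as a finite sum. -/
lemma finsum_form_eq_sum {ι G E : Type*} [Group G]
    [NormedAddCommGroup E] [InnerProductSpace ℂ E]
    {J : Set ι} (hJ : J.Finite) (p : ι → ι → G → (E →L[ℂ] E)) (φ : ι → G →₀ E) :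
    (∑ᶠ j ∈ J, ∑ᶠ k ∈ J, ∑ᶠ g : G, ∑ᶠ h : G, ⟪φ j g, p j k (g⁻¹ * h) (φ k h)⟫) =
      ∑ j ∈ hJ.toFinset, ∑ k ∈ hJ.toFinset,
        (φ j).sum fun g x => (φ k).sum fun h y => ⟪x, p j k (g⁻¹ * h) y⟫ := by
  rw [finsum_mem_eq_finite_toFinset_sum _ hJ]
  refine Finset.sum_congr rfl fun j _ => ?_
  rw [finsum_mem_eq_finite_toFinset_sum _ hJ]
  refine Finset.sum_congr rfl fun k _ => ?_
  have hinner : ∀ g, (∑ᶠ h : G, ⟪φ j g, p j k (g⁻¹ * h) (φ k h)⟫) =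
      (φ k).sum fun h y => ⟪φ j g, p j k (g⁻¹ * h) y⟫ := fun g =>
    finsum_eq_sum_of_support_subset _ fun h hh => by
      simp only [Finset.mem_coe, Finsupp.mem_support_iff]
      intro h0
      simp [h0] at hh
  simp only [hinner]
  exact finsum_eq_sum_of_support_subset _ fun g hg => by
    simp only [Finset.mem_coe, Finsupp.mem_support_iff]
    intro h0
    simp [h0] at hg

/-- A positive definite family is positive semidefinite. -/
lemma IsPDFamily.isPSDFamily {ι G E : Type*} [Group G]
    [NormedAddCommGroup E] [InnerProductSpace ℂ E] {J : Set ι} {p : ι → ι → G → (E →L[ℂ] E)}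
    (h : IsPDFamily J p) : IsPSDFamily J p := fun φ => by
  by_cases hφ : ∃ j ∈ J, φ j ≠ 0
  · exact ⟨(h φ hφ).1.le, (h φ hφ).2⟩
  · push Not at hφ
    have h0 : (∑ᶠ j ∈ J, ∑ᶠ k ∈ J, ∑ᶠ g : G, ∑ᶠ h : G,
        ⟪φ j g, p j k (g⁻¹ * h) (φ k h)⟫) = 0 := by
      rw [← finsum_mem_zero J]
      exact finsum_mem_congr rfl fun j hj => by simp [hφ j hj]
    simp [h0]

lemma inner_sum_finsuppSum {ι G E H : Type*} [Zero E]
    [NormedAddCommGroup H] [InnerProductSpace ℂ H]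
    (T : Finset ι) (φ : ι → G →₀ E) (V : ι → G → E → H) :
    ⟪∑ j ∈ T, (φ j).sum (V j), ∑ j ∈ T, (φ j).sum (V j)⟫ =
      ∑ j ∈ T, ∑ k ∈ T, (φ j).sum fun g x => (φ k).sum fun h y => ⟪V j g x, V k h y⟫ := by
  rw [sum_inner]
  refine Finset.sum_congr rfl fun j _ => ?_
  rw [inner_sum]
  refine Finset.sum_congr rfl fun k _ => ?_
  simp only [Finsupp.sum]
  rw [sum_inner]
  exact Finset.sum_congr rfl fun g _ => inner_sum _ _ _

/-- A family with a Gram representation in a sum of two Hilbert spaces is positive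
semidefinite. -/
lemma isPSDFamily_of_inner {ι G E H₁ H₂ : Type*} [Group G]
    [NormedAddCommGroup E] [InnerProductSpace ℂ E]
    [NormedAddCommGroup H₁] [InnerProductSpace ℂ H₁]
    [NormedAddCommGroup H₂] [InnerProductSpace ℂ H₂]
    {J : Set ι} (hJ : J.Finite) (p : ι → ι → G → (E →L[ℂ] E))
    (V : ι → G → E → H₁) (W : ι → G → E → H₂)
    (h : ∀ j ∈ J, ∀ k ∈ J, ∀ g h x y,
      ⟪x, p j k (g⁻¹ * h) y⟫ = ⟪V j g x, V k h y⟫ + ⟪W j g x, W k h y⟫) :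
    IsPSDFamily J p := fun φ => by
  set a := ∑ j ∈ hJ.toFinset, (φ j).sum (V j)
  set b := ∑ j ∈ hJ.toFinset, (φ j).sum (W j)
  have key : (∑ᶠ j ∈ J, ∑ᶠ k ∈ J, ∑ᶠ g : G, ∑ᶠ h : G,
      ⟪φ j g, p j k (g⁻¹ * h) (φ k h)⟫) = ⟪a, a⟫ + ⟪b, b⟫ := by
    rw [finsum_form_eq_sum hJ, inner_sum_finsuppSum, inner_sum_finsuppSum]
    simp only [← Finset.sum_add_distrib, Finsupp.sum]
    refine Finset.sum_congr rfl fun j hj => Finset.sum_congr rfl fun k hk =>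
      Finset.sum_congr rfl fun g _ => Finset.sum_congr rfl fun h' _ => ?_
    exact h j (hJ.mem_toFinset.mp hj) k (hJ.mem_toFinset.mp hk) g h' _ _
  rw [key, inner_self_eq_norm_sq_to_K, inner_self_eq_norm_sq_to_K]
  simp only [Complex.coe_algebraMap, ← Complex.ofReal_pow, ← Complex.ofReal_add,
    Complex.ofReal_re, Complex.ofReal_im, and_true]
  positivity

open scoped Classical in
/-- The operator matrix indexed by `ι × G` of a family, extended by zero outside `J`. -/
noncomputable def kernelMatrix {ι G E : Type*} [Group G]
    [NormedAddCommGroup E] [InnerProductSpace ℂ E] (J : Set ι) (p : ι → ι → G → (E →L[ℂ] E)) :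
    Matrix (ι × G) (ι × G) (E →L[ℂ] E) :=
  fun a b => if a.1 ∈ J ∧ b.1 ∈ J then p a.1 b.1 (a.2⁻¹ * b.2) else 0

lemma finsuppSum_eq_sum_curry {ι G E M : Type*} [AddCommMonoid E] [AddCommMonoid M]
    (f : ι × G →₀ E) (T : Finset ι) (F : ι → G → E → M) (hF : ∀ j ∉ T, ∀ g x, F j g x = 0) :
    (f.sum fun a => F a.1 a.2) = ∑ j ∈ T, (f.curry j).sum (F j) := by
  rw [← Finsupp.sum_curry_index]
  refine Finset.sum_congr_of_eq_on_inter (fun j _ hj => ?_) (fun j _ hj => ?_) fun _ _ _ => rfl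
  · simp [Finsupp.sum, hF j hj]
  · rw [Finsupp.notMem_support_iff.mp hj, Finsupp.sum_zero_index]

open scoped ComplexOrder in
lemma IsPSDFamily.posSemidef_kernelMatrix {ι G E : Type*} [Group G]
    [NormedAddCommGroup E] [InnerProductSpace ℂ E] [CompleteSpace E]
    {J : Set ι} (hJ : J.Finite) {p : ι → ι → G → (E →L[ℂ] E)}
    (hsym : ∀ j ∈ J, ∀ k ∈ J, ∀ g, p k j g = ContinuousLinearMap.adjoint (p j k g⁻¹))
    (h : IsPSDFamily J p) : (kernelMatrix J p).PosSemidef := by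
  have tfae := (RKHS.posSemidef_tfae (K := kernelMatrix J p)).out 0 2
  refine tfae.mpr ⟨?_, fun f => ?_⟩
  · ext a b : 1
    by_cases hab : a.1 ∈ J ∧ b.1 ∈ J
    · simp [kernelMatrix, Matrix.conjTranspose_apply, hab, ContinuousLinearMap.star_eq_adjoint,
        hsym b.1 hab.2 a.1 hab.1]
    · simp [kernelMatrix, Matrix.conjTranspose_apply, hab, and_comm]
  · have key : (f.sum fun a v => f.sum fun b w => ⟪kernelMatrix J p b a v, w⟫) =
        starRingEnd ℂ (∑ᶠ j ∈ J, ∑ᶠ k ∈ J, ∑ᶠ g : G, ∑ᶠ h : G,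
          ⟪f.curry j g, p j k (g⁻¹ * h) (f.curry k h)⟫) := by
      rw [finsum_form_eq_sum hJ, Finsupp.sum_comm, finsuppSum_eq_sum_curry f hJ.toFinset
        (fun j g w => f.sum fun a v => ⟪kernelMatrix J p (j, g) a v, w⟫) fun j hj g w => by
          simp [kernelMatrix, hJ.mem_toFinset.not.mp hj]]
      simp only [map_sum, map_finsuppSum, inner_conj_symm]
      refine Finset.sum_congr rfl fun j hj => ?_
      rw [Finsupp.sum, Finset.sum_congr rfl fun g _ => finsuppSum_eq_sum_curry f hJ.toFinset
        (fun k h v => ⟪kernelMatrix J p (j, g) (k, h) v, f.curry j g⟫) fun k hk h v => by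
          simp [kernelMatrix, hJ.mem_toFinset.not.mp hk], Finset.sum_comm]
      refine Finset.sum_congr rfl fun k hk => ?_
      simp only [kernelMatrix, hJ.mem_toFinset.mp hj, hJ.mem_toFinset.mp hk, and_self, if_true]
      rfl
    rw [key]
    simpa using (h f.curry).1

/-- Gram representation of a positive semidefinite family in a Hilbert space spanned by it. -/
lemma IsPSDFamily.exists_gram {ι G E : Type} [Group G]
    [NormedAddCommGroup E] [InnerProductSpace ℂ E] [CompleteSpace E]
    {J : Set ι} (hJ : J.Finite) {p : ι → ι → G → (E →L[ℂ] E)}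
    (hsym : ∀ j ∈ J, ∀ k ∈ J, ∀ g, p k j g = ContinuousLinearMap.adjoint (p j k g⁻¹))
    (h : IsPSDFamily J p) :
    ∃ (H : Type) (_ : NormedAddCommGroup H) (_ : InnerProductSpace ℂ H) (_ : CompleteSpace H)
      (V : ι × G → E →L[ℂ] H),
      (Submodule.span ℂ {u | ∃ a x, V a x = u}).topologicalClosure = ⊤ ∧
      ∀ a b x y, ⟪V a x, V b y⟫ = ⟪x, kernelMatrix J p a b y⟫ := by
  have : Fact (kernelMatrix J p).PosSemidef := ⟨h.posSemidef_kernelMatrix hJ hsym⟩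
  refine ⟨RKHS.OfKernel (kernelMatrix J p), inferInstance, inferInstance, inferInstance,
    RKHS.kerFun _, RKHS.kerFun_dense _, fun a b x y => ?_⟩
  rw [RKHS.kerFun_inner, RKHS.kerFun_apply, RKHS.OfKernel.kernel_ofKernel]

/-- Two families of operators with the same Gram matrix are intertwined by an isometry. -/
lemma exists_linearIsometry_of_inner_eq {X E H H' : Type*}
    [NormedAddCommGroup E] [InnerProductSpace ℂ E]
    [NormedAddCommGroup H] [InnerProductSpace ℂ H]
    [NormedAddCommGroup H'] [InnerProductSpace ℂ H'] [CompleteSpace H']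
    (V : X → E →L[ℂ] H) (W : X → E →L[ℂ] H')
    (hV : (Submodule.span ℂ {u | ∃ a x, V a x = u}).topologicalClosure = ⊤)
    (h : ∀ a b x y, ⟪V a x, V b y⟫ = ⟪W a x, W b y⟫) :
    ∃ U : H →ₗᵢ[ℂ] H', ∀ a x, U (V a x) = W a x := by
  let T : (X →₀ E) →ₗ[ℂ] H := Finsupp.lsum ℂ fun a => (V a : E →ₗ[ℂ] H)
  let S : (X →₀ E) →ₗ[ℂ] H' := Finsupp.lsum ℂ fun a => (W a : E →ₗ[ℂ] H')
  have hT : ∀ a x, T (Finsupp.single a x) = V a x := by simp [T]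
  have hS : ∀ a x, S (Finsupp.single a x) = W a x := by simp [S]
  have hnorm : ∀ f, ‖S f‖ = ‖T f‖ := fun f => by
    have : ⟪S f, S f⟫ = ⟪T f, T f⟫ := by
      simp only [S, T, Finsupp.lsum_apply, Finsupp.sum, sum_inner, inner_sum,
        ContinuousLinearMap.coe_coe, h]
    rw [@norm_eq_sqrt_re_inner ℂ, @norm_eq_sqrt_re_inner ℂ _ _ _ _ (T f), this]
  have hdense : DenseRange T := by
    have hle : Submodule.span ℂ {u | ∃ a x, V a x = u} ≤ LinearMap.range T := by
      rw [Submodule.span_le]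
      rintro _ ⟨a, x, rfl⟩
      exact ⟨_, hT a x⟩
    have := Submodule.dense_iff_topologicalClosure_eq_top.mpr hV
    exact this.mono hle
  let U := S.extendOfNorm T
  have hU : ∀ f, U (T f) = S f :=
    LinearMap.extendOfNorm_eq hdense ⟨1, fun f => by simp [hnorm f]⟩
  refine ⟨⟨U.toLinearMap, fun u => ?_⟩, fun a x => ?_⟩
  · induction u using hdense.induction_on with
    | hp => exact isClosed_eq (by fun_prop) (by fun_prop)
    | ih f => simp [hU, hnorm]
  · simpa [hT, hS] using hU (Finsupp.single a x)

lemma eq_of_inner_gram_eq {X E H : Type*}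
    [NormedAddCommGroup E] [InnerProductSpace ℂ E] [NormedAddCommGroup H] [InnerProductSpace ℂ H]
    {V : X → E →L[ℂ] H} (hV : (Submodule.span ℂ {u | ∃ a x, V a x = u}).topologicalClosure = ⊤)
    {u v : H} (h : ∀ a x, ⟪V a x, u⟫ = ⟪V a x, v⟫) : u = v := by
  refine (Submodule.dense_iff_topologicalClosure_eq_top.mpr hV).eq_of_inner_right ℂ fun w hw => ?_
  induction hw using Submodule.span_induction with
  | mem w hw => obtain ⟨a, x, rfl⟩ := hw; exact h a x
  | zero => simp
  | add _ _ _ _ h₁ h₂ => simp [inner_add_left, h₁, h₂]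
  | smul _ _ _ h => simp [inner_smul_left, h]

/-- If a spanning family is translation covariant, then so are the inner products between
vector-valued functions covariant against it. -/
lemma inner_eq_inner_one_of_covariant {ι G E H : Type*} [Group G]
    [NormedAddCommGroup E] [InnerProductSpace ℂ E]
    [NormedAddCommGroup H] [InnerProductSpace ℂ H] [CompleteSpace H]
    {V : ι × G → E →L[ℂ] H}
    (hV : (Submodule.span ℂ {u | ∃ a x, V a x = u}).topologicalClosure = ⊤)
    (hcov : ∀ c j k g h x y, ⟪V (j, c * g) x, V (k, c * h) y⟫ = ⟪V (j, g) x, V (k, h) y⟫)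
    {r s : G → H}
    (hr : ∀ c j g h x, ⟪V (j, c * g) x, r (c * h)⟫ = ⟪V (j, g) x, r h⟫)
    (hs : ∀ c j g h x, ⟪V (j, c * g) x, s (c * h)⟫ = ⟪V (j, g) x, s h⟫) (g h : G) :
    ⟪r g, s h⟫ = ⟪r 1, s (g⁻¹ * h)⟫ := by
  obtain ⟨L, hL⟩ := exists_linearIsometry_of_inner_eq V (fun a => V (a.1, g * a.2)) hV
    fun a b x y => (hcov g a.1 b.1 a.2 b.2 x y).symm
  have hLr : ∀ t : G → H, (∀ c j g h x, ⟪V (j, c * g) x, t (c * h)⟫ = ⟪V (j, g) x, t h⟫) →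
      ∀ h, L (t h) = t (g * h) := fun t ht h => by
    refine eq_of_inner_gram_eq hV fun a x => ?_
    have := hL (a.1, g⁻¹ * a.2) x
    simp only [mul_inv_cancel_left] at this
    rw [← this, L.inner_map_map, this, ← ht g, mul_inv_cancel_left]
  have := L.inner_map_map (r 1) (s (g⁻¹ * h))
  rwa [hLr r hr, hLr s hs, mul_one, mul_inv_cancel_left] at this

/-- The Parrott theorem for psd functions on a group. -/
theorem stmt6
    (G : Type) [Group G]
    (E : Type) [NormedAddCommGroup E] [InnerProductSpace ℂ E] [CompleteSpace E]
    (N : ℕ) (hN : 0 < N)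
    (p : ℤ → ℤ → G → (E →L[ℂ] E))
    (hsym : ∀ j k : ℤ, j ∈ Set.Icc 0 (N : ℤ) → k ∈ Set.Icc 0 (N : ℤ) →
      ¬(j = 0 ∧ k = (N : ℤ)) → ¬(j = (N : ℤ) ∧ k = 0) →
      ∀ g : G, p k j g = ContinuousLinearMap.adjoint (p j k g⁻¹))
    (hP : IsPSDFamily (Set.Icc 0 ((N : ℤ) - 1)) p)
    (hQ : IsPSDFamily (Set.Icc 1 (N : ℤ)) p)
    (hA : IsPDFamily ({0} : Set ℤ) p)
    (hB : IsPDFamily (Set.Icc 1 ((N : ℤ) - 1)) p)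
    (hC : IsPDFamily ({(N : ℤ)} : Set ℤ) p) :
    ∃ q : G → (E →L[ℂ] E), ∃ p' : ℤ → ℤ → G → (E →L[ℂ] E),
      (∀ j k : ℤ, ¬(j = 0 ∧ k = (N : ℤ)) → ¬(j = (N : ℤ) ∧ k = 0) → p' j k = p j k) ∧
      p' 0 (N : ℤ) = q ∧
      (∀ g : G, p' (N : ℤ) 0 g = ContinuousLinearMap.adjoint (q g⁻¹)) ∧
      IsPSDFamily (Set.Icc 0 (N : ℤ)) p' := by
  have hJP : (Set.Icc 0 ((N : ℤ) - 1)).Finite := Set.finite_Icc _ _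
  have hJB : (Set.Icc 1 ((N : ℤ) - 1)).Finite := Set.finite_Icc _ _
  have hJQ : (Set.Icc 1 (N : ℤ)).Finite := Set.finite_Icc _ _
  have hN' : (0 : ℤ) < N := by exact_mod_cast hN
  simp only [Set.mem_Icc] at hsym
  obtain ⟨HP, _, _, _, VP, -, gP⟩ := hP.exists_gram hJP fun j hj k hk =>
    hsym j k (by grind) (by grind) (by grind) (by grind)
  obtain ⟨HQ, _, _, _, VQ, -, gQ⟩ := hQ.exists_gram hJQ fun j hj k hk =>
    hsym j k (by grind) (by grind) (by grind) (by grind)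
  obtain ⟨HB, _, _, _, VB, dB, gB⟩ := hB.isPSDFamily.exists_gram hJB fun j hj k hk =>
    hsym j k (by grind) (by grind) (by grind) (by grind)
  classical
  obtain ⟨UP, hUP⟩ := exists_linearIsometry_of_inner_eq VB
    (fun a => if a.1 ∈ Set.Icc 1 ((N : ℤ) - 1) then VP a else 0) dB fun a b x y => by
      simp only [gB, kernelMatrix]
      split_ifs <;> simp [gP, kernelMatrix] <;> grind
  obtain ⟨UQ, hUQ⟩ := exists_linearIsometry_of_inner_eq VB
    (fun a => if a.1 ∈ Set.Icc 1 ((N : ℤ) - 1) then VQ a else 0) dB fun a b x y => by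
      simp only [gB, kernelMatrix]
      split_ifs <;> simp [gQ, kernelMatrix] <;> grind
  have hUP' : ∀ j ∈ Set.Icc 1 ((N : ℤ) - 1), ∀ g x, UP (VB (j, g) x) = VP (j, g) x :=
    fun j hj g x => by simpa [Set.mem_Icc.mp hj] using hUP (j, g) x
  have hUQ' : ∀ j ∈ Set.Icc 1 ((N : ℤ) - 1), ∀ g x, UQ (VB (j, g) x) = VQ (j, g) x :=
    fun j hj g x => by simpa [Set.mem_Icc.mp hj] using hUQ (j, g) x
  have hVB0 : ∀ j ∉ Set.Icc 1 ((N : ℤ) - 1), ∀ g x, VB (j, g) x = 0 := fun j hj g x => by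
    rw [← inner_self_eq_zero (𝕜 := ℂ), gB]
    simp only [kernelMatrix, hj, false_and, if_false, zero_apply,
      inner_zero_right]
  let UPc : HB →L[ℂ] HP := UP.toContinuousLinearMap
  let UQc : HB →L[ℂ] HQ := UQ.toContinuousLinearMap
  let R : G → E →L[ℂ] HB := fun g => UPc.adjoint ∘L VP (0, g)
  let S : G → E →L[ℂ] HB := fun g => UQc.adjoint ∘L VQ ((N : ℤ), g)
  have hR : ∀ u g x, ⟪u, R g x⟫ = ⟪UP u, VP (0, g) x⟫ := fun u g x =>
    ContinuousLinearMap.adjoint_inner_right UPc u _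
  have hS : ∀ u g x, ⟪u, S g x⟫ = ⟪UQ u, VQ ((N : ℤ), g) x⟫ := fun u g x =>
    ContinuousLinearMap.adjoint_inner_right UQc u _
  let q : G → (E →L[ℂ] E) := fun g => (R 1).adjoint ∘L S g
  have hq : ∀ g h x y, ⟪x, q (g⁻¹ * h) y⟫ = ⟪R g x, S h y⟫ := fun g h x y => by
    rw [inner_eq_inner_one_of_covariant dB (r := fun g => R g x) (s := fun g => S g y)]
    · exact ContinuousLinearMap.adjoint_inner_right (R 1) x _
    · intro c j k g h x y
      simp [gB, kernelMatrix, mul_assoc]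
    · intro c j g h z
      by_cases hj : j ∈ Set.Icc 1 ((N : ℤ) - 1)
      · simp [hR, hUP' j hj, gP, kernelMatrix, mul_assoc]
      · simp [hVB0 j hj]
    · intro c j g h z
      by_cases hj : j ∈ Set.Icc 1 ((N : ℤ) - 1)
      · simp [hS, hUQ' j hj, gQ, kernelMatrix, mul_assoc]
      · simp [hVB0 j hj]
  let p' : ℤ → ℤ → G → (E →L[ℂ] E) := fun j k =>
    if j = 0 ∧ k = N then q else
      if j = N ∧ k = 0 then fun g => ContinuousLinearMap.adjoint (q g⁻¹) else p j k
  have hp' : ∀ j k : ℤ, ¬(j = 0 ∧ k = (N : ℤ)) → ¬(j = (N : ℤ) ∧ k = 0) → p' j k = p j k :=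
    fun j k h₁ h₂ => by simp only [p', h₁, h₂, if_false]
  have hp'0N : p' 0 N = q := by simp [p']
  have hp'N0 : ∀ g, p' N 0 g = ContinuousLinearMap.adjoint (q g⁻¹) := fun g => by
    simp [p', hN.ne']
  refine ⟨q, p', hp', hp'0N, hp'N0, ?_⟩
  have hsym' : ∀ j ∈ Set.Icc 0 (N : ℤ), ∀ k ∈ Set.Icc 0 (N : ℤ), ∀ g,
      p' k j g = ContinuousLinearMap.adjoint (p' j k g⁻¹) := fun j hj k hk g => by
    by_cases h₁ : j = 0 ∧ k = (N : ℤ)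
    · rw [h₁.1, h₁.2, hp'N0, hp'0N]
    by_cases h₂ : j = (N : ℤ) ∧ k = 0
    · rw [h₂.1, h₂.2, hp'N0, hp'0N, inv_inv, ContinuousLinearMap.adjoint_adjoint]
    rw [hp' j k h₁ h₂, hp' k j (by tauto) (by tauto), hsym j k hj hk h₁ h₂]
  let V : ℤ → G → E → HP := fun j g x => if j = N then UP (S g x) else VP (j, g) x
  let W : ℤ → G → E → HQ := fun j g x =>
    if j = N then VQ ((N : ℤ), g) x - UQ (S g x) else 0
  have hcorner : ∀ j ∈ Set.Icc 0 (N : ℤ), ∀ g h x y,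
      ⟪x, p' j N (g⁻¹ * h) y⟫ = ⟪V j g x, V N h y⟫ + ⟪W j g x, W N h y⟫ := by
    intro j hj g h x y
    rw [Set.mem_Icc] at hj
    by_cases hjN : j = N
    · subst hjN
      have hSS : ∀ z g x, ⟪S g x, z⟫ = ⟪VQ ((N : ℤ), g) x, UQ z⟫ := fun z g x => by
        rw [← inner_conj_symm, hS, inner_conj_symm]
      have hNQ : (1 : ℤ) ≤ N := hN'
      simp [V, W, ← hS, ← hSS, gQ, kernelMatrix, hNQ,
        hp' N N (by grind) (by grind)]
    · by_cases hj0 : j = 0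
      · subst hj0
        simp only [V, W, hjN, if_true, if_false, inner_zero_left, add_zero]
        rw [hp'0N, hq, ← inner_conj_symm, hR, inner_conj_symm]
      · have hjB : j ∈ Set.Icc 1 ((N : ℤ) - 1) := by grind
        have hjQ : j ∈ Set.Icc 1 (N : ℤ) ∧ (N : ℤ) ∈ Set.Icc 1 (N : ℤ) := by grind
        simp only [V, W, hjN, if_true, if_false, inner_zero_left, add_zero]
        rw [← hUP' j hjB, UP.inner_map_map, hS, hUQ' j hjB, gQ, hp' j N (by grind) (by grind)]
        simp only [kernelMatrix, hjQ, and_self, if_true]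
  refine isPSDFamily_of_inner (Set.finite_Icc _ _) p' V W fun j hj k hk g h x y => ?_
  by_cases hkN : k = N
  · subst hkN
    exact hcorner j hj g h x y
  by_cases hjN : j = N
  · subst hjN
    rw [hsym' k hk N hj, ContinuousLinearMap.adjoint_inner_right, ← inner_conj_symm, mul_inv_rev,
      inv_inv, hcorner k hk, map_add, inner_conj_symm, inner_conj_symm]
  · have hjk : j ∈ Set.Icc 0 ((N : ℤ) - 1) ∧ k ∈ Set.Icc 0 ((N : ℤ) - 1) := by
      simp only [Set.mem_Icc] at hj hk ⊢
      omega
    rw [hp' j k (fun h => hkN h.2) (fun h => hjN h.1)]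
    simp only [V, W, hjN, hkN, if_false, inner_zero_left, add_zero]
    rw [gP, kernelMatrix, if_pos hjk]
end

section
/- Let G be a group, E a complex Hilbert space, and M, N positive integers. Put E₀ = {(j,N) : −M ≤ j ≤ 0} ∪ {(N,j) : −M ≤ j ≤ 0}. Suppose functions p_{j,k} : G → B(E) are given for all (j,k) ∈ {−M,…,N}² ∖ E₀, satisfying p_{k,j}(g) = (p_{j,k}(g⁻¹))* for all such pairs and all g ∈ G. If the families (p_{j,k}) indexed by {−M,…,N−1}² and by {1,…,N}² are both positive semidefinite, then there exist functions p_{j,k} : G → B(E) for (j,k) ∈ E₀, with p_{N,j}(g) = (p_{j,N}(g⁻¹))*, such that the full family (p_{j,k}) indexed by {−M,…,N}² is positive semidefinite. -/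
open scoped ComplexInnerProductSpace

/-- A positive semidefinite sesquilinear form is the pullback of the inner product of a Hilbert
space along a linear map with dense range. -/
theorem exists_denseRange_inner_eq.{u} {F : Type u} [AddCommGroup F] [Module ℂ F]
    (β : F →ₗ⋆[ℂ] F →ₗ[ℂ] ℂ)
    (hsymm : ∀ x y, starRingEnd ℂ (β x y) = β y x) (hpos : ∀ x, 0 ≤ (β x x).re) :
    ∃ (H : Type u) (_ : NormedAddCommGroup H) (_ : InnerProductSpace ℂ H) (_ : CompleteSpace H)
      (ρ : F →ₗ[ℂ] H), DenseRange ρ ∧ ∀ x y, ⟪ρ x, ρ y⟫ = β x y := by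
  let c : PreInnerProductSpace.Core ℂ F :=
    { inner x y := β x y
      conj_inner_symm x y := hsymm y x
      re_inner_nonneg := hpos
      add_left x y z := by simp
      smul_left x y r := by simp }
  let : SeminormedAddCommGroup F := InnerProductSpace.Core.toSeminormedAddCommGroup (c := c)
  let : InnerProductSpace ℂ F := InnerProductSpace.ofCore c
  refine ⟨UniformSpace.Completion F, inferInstance, inferInstance, inferInstance,
    (UniformSpace.Completion.toComplₗᵢ (𝕜 := ℂ) (E := F)).toLinearMap,
    UniformSpace.Completion.denseRange_coe, fun x y => ?_⟩
  exact UniformSpace.Completion.inner_coe x y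

/-- A linear map that has the same Gram form as a linear map with dense range factors through it
by an operator on the Hilbert space. -/
theorem exists_extension_of_inner_eq {F H K : Type*} [AddCommGroup F] [Module ℂ F]
    [NormedAddCommGroup H] [InnerProductSpace ℂ H] [NormedAddCommGroup K] [InnerProductSpace ℂ K]
    [CompleteSpace K] {ρ : F →ₗ[ℂ] H} (hρ : DenseRange ρ) (σ : F →ₗ[ℂ] K)
    (h : ∀ x, ⟪σ x, σ x⟫ = ⟪ρ x, ρ x⟫) :
    ∃ U : H →L[ℂ] K, (∀ x, U (ρ x) = σ x) ∧ ‖U‖ ≤ 1 := by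
  have hn : ∀ x, ‖σ x‖ ≤ 1 * ‖ρ x‖ := fun x => by
    rw [one_mul, @norm_eq_sqrt_re_inner ℂ, @norm_eq_sqrt_re_inner ℂ _ _ _ _ (ρ x), h]
  exact ⟨σ.extendOfNorm ρ, LinearMap.extendOfNorm_eq hρ ⟨1, hn⟩,
    LinearMap.opNorm_extendOfNorm_le hρ zero_le_one hn⟩

/-- Two positive semidefinite forms that agree on the range of `m` admit a contractive coupling
`τ`, extending their common values and inheriting their common symmetries. -/
theorem exists_coupling {F : Type*} [AddCommGroup F] [Module ℂ F]
    (β₁ β₂ : F →ₗ⋆[ℂ] F →ₗ[ℂ] ℂ)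
    (hsymm₁ : ∀ x y, starRingEnd ℂ (β₁ x y) = β₁ y x) (hpos₁ : ∀ x, 0 ≤ (β₁ x x).re)
    (hsymm₂ : ∀ x y, starRingEnd ℂ (β₂ x y) = β₂ y x) (hpos₂ : ∀ x, 0 ≤ (β₂ x x).re)
    (m : F →ₗ[ℂ] F) (hm : ∀ a b, β₁ (m a) (m b) = β₂ (m a) (m b)) :
    ∃ τ : F →ₗ⋆[ℂ] F →ₗ[ℂ] ℂ, (∀ a y, τ (m a) y = β₂ (m a) y) ∧
      (∀ x y, ‖τ x y‖ ≤ √(β₁ x x).re * √(β₂ y y).re) ∧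
      ∀ L : F →ₗ[ℂ] F, Function.Surjective L → (∀ x, m (L x) = L (m x)) →
        (∀ x y, β₁ (L x) (L y) = β₁ x y) → (∀ x y, β₂ (L x) (L y) = β₂ x y) →
        ∀ x y, τ (L x) (L y) = τ x y := by
  obtain ⟨H₁, _, _, _, ρ₁, -, h₁⟩ := exists_denseRange_inner_eq β₁ hsymm₁ hpos₁
  obtain ⟨H₂, _, _, _, ρ₂, -, h₂⟩ := exists_denseRange_inner_eq β₂ hsymm₂ hpos₂
  obtain ⟨H, _, _, _, ρ, hρ, h⟩ := exists_denseRange_inner_eq ((β₁.comp m).compl₂ m)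
    (fun x y => by simpa using hsymm₁ (m x) (m y)) (fun x => by simpa using hpos₁ (m x))
  simp only [LinearMap.compl₂_apply, LinearMap.comp_apply] at h
  obtain ⟨ι₁, hι₁, n₁⟩ := exists_extension_of_inner_eq hρ (ρ₁ ∘ₗ m) fun x => by
    rw [h, LinearMap.comp_apply, h₁]
  obtain ⟨ι₂, hι₂, n₂⟩ := exists_extension_of_inner_eq hρ (ρ₂ ∘ₗ m) fun x => by
    rw [h, LinearMap.comp_apply, h₂, hm]
  simp only [LinearMap.comp_apply] at hι₁ hι₂
  let w : F →ₗ[ℂ] H := (ContinuousLinearMap.adjoint ι₂).toLinearMap ∘ₗ ρ₂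
  have hw : ∀ b y, ⟪ρ b, w y⟫ = β₂ (m b) y := fun b y => by
    simp [w, ContinuousLinearMap.adjoint_inner_right, hι₂, h₂]
  have eq_of_inner : ∀ u v : H, (∀ b, ⟪ρ b, u⟫ = ⟪ρ b, v⟫) → u = v := fun u v huv =>
    ext_inner_left ℂ fun z => by
      refine hρ.induction_on (p := fun z => ⟪z, u⟫ = ⟪z, v⟫) z ?_ huv
      exact isClosed_eq (by fun_prop) (by fun_prop)
  have hw_norm : ∀ y, ‖w y‖ ≤ ‖ρ₂ y‖ := fun y => by
    refine ((ContinuousLinearMap.adjoint ι₂).le_opNorm (ρ₂ y)).trans ?_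
    rw [LinearIsometryEquiv.norm_map]
    exact mul_le_of_le_one_left (norm_nonneg _) n₂
  refine ⟨LinearMap.mk₂'ₛₗ _ _ (fun x y => ⟪ρ₁ x, ι₁ (w y)⟫)
    (by simp) (fun c x y => by rw [map_smul, inner_smul_left, smul_eq_mul])
    (by simp) (by simp), ?_, ?_, ?_⟩
  · intro a y
    rw [LinearMap.mk₂'ₛₗ_apply, ← hw]
    refine hρ.induction_on (p := fun z => ⟪ρ₁ (m a), ι₁ z⟫ = ⟪ρ a, z⟫) (w y)
      (isClosed_eq (by fun_prop) (by fun_prop)) fun b => ?_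
    rw [hι₁, h₁, h]
  · intro x y
    rw [LinearMap.mk₂'ₛₗ_apply, ← h₁, ← h₂]
    refine (norm_inner_le_norm _ _).trans ?_
    rw [@norm_eq_sqrt_re_inner ℂ _ _ _ _ (ρ₁ x)]
    refine mul_le_mul_of_nonneg_left ?_ (Real.sqrt_nonneg _)
    refine ((ι₁.le_opNorm _).trans (mul_le_of_le_one_left (norm_nonneg _) n₁)).trans ?_
    exact (hw_norm y).trans (@norm_eq_sqrt_re_inner ℂ _ _ _ _ (ρ₂ y)).le
  · intro L hL hmL hL₁ hL₂ x y
    obtain ⟨U, hU, -⟩ := exists_extension_of_inner_eq hρ (ρ ∘ₗ L)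
      fun x => by rw [LinearMap.comp_apply, h, h, hmL, hL₁]
    simp only [LinearMap.comp_apply] at hU
    have hwL : w (L y) = U (w y) := eq_of_inner _ _ fun b => by
      obtain ⟨b, rfl⟩ := hL b
      rw [hw, hmL, hL₂, ← hw]
      refine hρ.induction_on (p := fun z => ⟪ρ b, z⟫ = ⟪ρ (L b), U z⟫) (w y)
        (isClosed_eq (by fun_prop) (by fun_prop)) fun a => ?_
      rw [hU, h, h, hmL, hmL, hL₁]
    rw [LinearMap.mk₂'ₛₗ_apply, LinearMap.mk₂'ₛₗ_apply, hwL]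
    refine hρ.induction_on (p := fun z => ⟪ρ₁ (L x), ι₁ (U z)⟫ = ⟪ρ₁ x, ι₁ z⟫) (w y)
      (isClosed_eq (by fun_prop) (by fun_prop)) fun a => ?_
    rw [hU, hι₁, hι₁, h₁, h₁, hmL, hL₁]

section ConvolutionForm

variable {G : Type*} [Group G] {E : Type*} [NormedAddCommGroup E] [InnerProductSpace ℂ E]

/-- The sesquilinear form `(u, v) ↦ ∑ g, ∑ h, ⟪u g, P (g⁻¹ * h) (v h)⟫` on finitely supported
functions. -/
noncomputable def convForm (P : G → E →L[ℂ] E) : (G →₀ E) →ₗ⋆[ℂ] (G →₀ E) →ₗ[ℂ] ℂ :=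
  LinearMap.mk₂'ₛₗ _ _ (fun u v => u.sum fun g e => v.sum fun h e' => ⟪e, P (g⁻¹ * h) e'⟫)
    (fun u u' v => Finsupp.sum_add_index' (by simp) fun g e e' => by
      simp [Finsupp.sum_add])
    (fun c u v => by
      rw [Finsupp.sum_smul_index' (by simp), Finsupp.smul_sum]
      refine Finsupp.sum_congr fun g _ => ?_
      rw [Finsupp.smul_sum]
      simp only [inner_smul_left, smul_eq_mul])
    (fun u v v' => by
      rw [← Finsupp.sum_add]
      refine Finsupp.sum_congr fun g _ => Finsupp.sum_add_index' (by simp) fun h e e' => ?_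
      rw [map_add, inner_add_right])
    (fun c u v => by
      rw [Finsupp.smul_sum]
      refine Finsupp.sum_congr fun g _ => ?_
      rw [Finsupp.sum_smul_index' (by simp), Finsupp.smul_sum]
      simp)

theorem convForm_apply (P : G → E →L[ℂ] E) (u v : G →₀ E) :
    convForm P u v = u.sum fun g e => v.sum fun h e' => ⟪e, P (g⁻¹ * h) e'⟫ := rfl

@[simp]
theorem convForm_single (P : G → E →L[ℂ] E) (g h : G) (e e' : E) :
    convForm P (Finsupp.single g e) (Finsupp.single h e') = ⟪e, P (g⁻¹ * h) e'⟫ := by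
  simp [convForm_apply]

theorem conj_convForm [CompleteSpace E] (P : G → E →L[ℂ] E) (u v : G →₀ E) :
    starRingEnd ℂ (convForm P u v) =
      convForm (fun g => ContinuousLinearMap.adjoint (P g⁻¹)) v u := by
  simp only [convForm_apply, Finsupp.sum, map_sum, inner_conj_symm]
  rw [Finset.sum_comm]
  simp [ContinuousLinearMap.adjoint_inner_right]

theorem convForm_mapDomain_mul_left (P : G → E →L[ℂ] E) (g : G) (u v : G →₀ E) :
    convForm P (u.mapDomain (g * ·)) (v.mapDomain (g * ·)) = convForm P u v := by
  rw [convForm_apply, Finsupp.sum_mapDomain_index_inj (mul_right_injective g)]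
  simp only [Finsupp.sum_mapDomain_index_inj (mul_right_injective g)]
  simp [convForm_apply, mul_assoc]

theorem finsum_finsum_inner_eq_convForm (P : G → E →L[ℂ] E) (u v : G →₀ E) :
    ∑ᶠ g : G, ∑ᶠ h : G, ⟪u g, P (g⁻¹ * h) (v h)⟫ = convForm P u v := by
  have hv : ∀ g, ∑ᶠ h : G, ⟪u g, P (g⁻¹ * h) (v h)⟫ =
      v.sum fun h e' => ⟪u g, P (g⁻¹ * h) e'⟫ := fun g =>
    finsum_eq_sum_of_support_subset _ fun h hh => by
      simp only [Function.mem_support, Finset.mem_coe, Finsupp.mem_support_iff] at hh ⊢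
      exact fun h0 => hh (by simp [h0])
  simp only [hv]
  exact finsum_eq_sum_of_support_subset _ fun g hg => by
    simp only [Function.mem_support, Finset.mem_coe, Finsupp.mem_support_iff] at hg ⊢
    exact fun h0 => hg (by simp [h0])

/-- A translation invariant sesquilinear form that is bounded on point masses is a convolution
form. -/
theorem exists_eq_convForm [CompleteSpace E] (t : (G →₀ E) →ₗ⋆[ℂ] (G →₀ E) →ₗ[ℂ] ℂ)
    (hinv : ∀ (g : G) u v, t (u.mapDomain (g * ·)) (v.mapDomain (g * ·)) = t u v)
    (hbd : ∀ g : G, ∃ C : ℝ, ∀ e e',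
      ‖t (Finsupp.single 1 e) (Finsupp.single g e')‖ ≤ C * ‖e‖ * ‖e'‖) :
    ∃ q : G → E →L[ℂ] E, t = convForm q := by
  choose C hC using hbd
  let s (g : G) : E →ₗ⋆[ℂ] E →ₗ[ℂ] ℂ :=
    (t.comp (Finsupp.lsingle 1)).compl₂ (Finsupp.lsingle g)
  let b (g : G) : E →L⋆[ℂ] E →L[ℂ] ℂ := (s g).mkContinuous₂ (C g) (hC g)
  refine ⟨fun g => ContinuousLinearMap.adjoint (InnerProductSpace.continuousLinearMapOfBilin (b g)),
    ?_⟩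
  have hs : ∀ g h e e', t (Finsupp.single g e) (Finsupp.single h e') =
      t (Finsupp.single 1 e) (Finsupp.single (g⁻¹ * h) e') := fun g h e e' => by
    rw [← hinv g⁻¹]
    simp [Finsupp.mapDomain_single]
  refine Finsupp.lhom_ext' fun g => LinearMap.ext fun e => Finsupp.lhom_ext' fun h =>
    LinearMap.ext fun e' => ?_
  simp only [LinearMap.comp_apply, Finsupp.lsingle_apply, convForm_single,
    ContinuousLinearMap.adjoint_inner_right, InnerProductSpace.continuousLinearMapOfBilin_apply]
  exact hs g h e e'

end ConvolutionForm

section Mask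

variable {ι : Type*} [DecidableEq ι] {G : Type*} {E : Type*} [NormedAddCommGroup E]
  [InnerProductSpace ℂ E]

/-- Restriction of a family to the index set `S`, extended by zero. -/
noncomputable def mask (G E : Type*) [NormedAddCommGroup E] [InnerProductSpace ℂ E]
    (S : Finset ι) : (ι → G →₀ E) →ₗ[ℂ] (ι → G →₀ E) :=
  ∑ j ∈ S, LinearMap.single ℂ (fun _ => G →₀ E) j ∘ₗ LinearMap.proj j

theorem mask_eq_sum (S : Finset ι) (φ : ι → G →₀ E) :
    mask G E S φ = ∑ j ∈ S, Pi.single j (φ j) := by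
  simp [mask, LinearMap.sum_apply]

theorem mask_apply (S : Finset ι) (φ : ι → G →₀ E) (j : ι) :
    mask G E S φ j = if j ∈ S then φ j else 0 := by
  simp [mask_eq_sum, Finset.sum_apply, Finset.sum_pi_single]

theorem mask_single {S : Finset ι} {j : ι} (hj : j ∈ S) (u : G →₀ E) :
    mask G E S (Pi.single j u) = Pi.single j u :=
  funext fun k => by
    rcases eq_or_ne k j with rfl | h
    · simp [mask_apply, hj]
    · simp [mask_apply, h]

end Mask

section FamilyForm

variable {ι : Type*} {G : Type*} [Group G] {E : Type*} [NormedAddCommGroup E]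
  [InnerProductSpace ℂ E]

/-- The sesquilinear form of the family `p` restricted to the index set `S`. -/
noncomputable def familyForm (S : Finset ι) (p : ι → ι → G → (E →L[ℂ] E)) :
    (ι → G →₀ E) →ₗ⋆[ℂ] (ι → G →₀ E) →ₗ[ℂ] ℂ :=
  ∑ j ∈ S, ∑ k ∈ S, ((convForm (p j k)).comp (LinearMap.proj j)).compl₂ (LinearMap.proj k)

theorem familyForm_apply (S : Finset ι) (p : ι → ι → G → (E →L[ℂ] E)) (φ ψ : ι → G →₀ E) :
    familyForm S p φ ψ = ∑ j ∈ S, ∑ k ∈ S, convForm (p j k) (φ j) (ψ k) := by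
  simp [familyForm, LinearMap.sum_apply]

theorem isPSDFamily_iff (S : Finset ι) (p : ι → ι → G → (E →L[ℂ] E)) :
    IsPSDFamily (S : Set ι) p ↔
      ∀ φ, 0 ≤ (familyForm S p φ φ).re ∧ (familyForm S p φ φ).im = 0 := by
  have h : ∀ φ : ι → G →₀ E, ∑ᶠ j ∈ (S : Set ι), ∑ᶠ k ∈ (S : Set ι), ∑ᶠ g : G, ∑ᶠ h : G,
      ⟪φ j g, p j k (g⁻¹ * h) (φ k h)⟫ = familyForm S p φ φ := fun φ => by
    simp only [finsum_finsum_inner_eq_convForm, finsum_mem_coe_finset, familyForm_apply]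
  simp only [IsPSDFamily, h]

theorem conj_familyForm [CompleteSpace E] {S : Finset ι} {p : ι → ι → G → (E →L[ℂ] E)}
    (hp : ∀ j ∈ S, ∀ k ∈ S, ∀ g, p k j g = ContinuousLinearMap.adjoint (p j k g⁻¹))
    (φ ψ : ι → G →₀ E) :
    starRingEnd ℂ (familyForm S p φ ψ) = familyForm S p ψ φ := by
  simp only [familyForm_apply, map_sum]
  rw [Finset.sum_comm]
  refine Finset.sum_congr rfl fun k hk => Finset.sum_congr rfl fun j hj => ?_
  rw [conj_convForm, ← funext (hp j hj k hk)]

/-- The diagonal action of left translation on families of finitely supported functions. -/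
noncomputable def translateFamily (ι : Type*) (E : Type*) [NormedAddCommGroup E]
    [InnerProductSpace ℂ E] (g : G) : (ι → G →₀ E) →ₗ[ℂ] (ι → G →₀ E) :=
  (Finsupp.lmapDomain E ℂ (g * ·)).compLeft ι

@[simp]
theorem translateFamily_apply (g : G) (φ : ι → G →₀ E) (j : ι) :
    translateFamily ι E g φ j = (φ j).mapDomain (g * ·) := rfl

theorem translateFamily_surjective (g : G) : Function.Surjective (translateFamily ι E g) :=
    fun φ => by
  refine ⟨translateFamily ι E g⁻¹ φ, funext fun j => ?_⟩
  rw [translateFamily_apply, translateFamily_apply, ← Finsupp.mapDomain_comp]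
  simpa only [Function.comp_def, mul_inv_cancel_left] using! Finsupp.mapDomain_id (v := φ j)

theorem familyForm_translateFamily (S : Finset ι) (p : ι → ι → G → (E →L[ℂ] E)) (g : G)
    (φ ψ : ι → G →₀ E) :
    familyForm S p (translateFamily ι E g φ) (translateFamily ι E g ψ) = familyForm S p φ ψ := by
  simp [familyForm_apply, convForm_mapDomain_mul_left]

variable [DecidableEq ι]

theorem translateFamily_single (g : G) (j : ι) (u : G →₀ E) :
    translateFamily ι E g (Pi.single j u) = Pi.single j (u.mapDomain (g * ·)) :=
  funext fun k => by
    rcases eq_or_ne k j with rfl | h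
    · simp
    · simp [h]

theorem familyForm_single {S : Finset ι} (p : ι → ι → G → (E →L[ℂ] E)) {j k : ι} (hj : j ∈ S)
    (hk : k ∈ S) (u v : G →₀ E) :
    familyForm S p (Pi.single j u) (Pi.single k v) = convForm (p j k) u v := by
  rw [familyForm_apply, Finset.sum_eq_single_of_mem j hj, Finset.sum_eq_single_of_mem k hk]
  · simp
  · intro k' _ h
    simp [h]
  · intro j' _ h
    simp [h]

theorem mask_translateFamily (S : Finset ι) (g : G) (φ : ι → G →₀ E) :
    mask G E S (translateFamily ι E g φ) = translateFamily ι E g (mask G E S φ) := by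
  simp [mask_eq_sum, translateFamily_single]

theorem familyForm_mask {S T : Finset ι} (h : T ⊆ S) (p : ι → ι → G → (E →L[ℂ] E))
    (φ ψ : ι → G →₀ E) :
    familyForm S p (mask G E T φ) (mask G E T ψ) = familyForm T p φ ψ := by
  simp only [mask_eq_sum, map_sum, LinearMap.sum_apply, familyForm_apply T]
  rw [Finset.sum_comm]
  exact Finset.sum_congr rfl fun j hj => Finset.sum_congr rfl fun k hk =>
    familyForm_single p (h hj) (h hk) _ _

end FamilyForm

/-- Completion along one index: if `p` is positive semidefinite on `A ∪ B` and on `B ∪ {n}`, the missing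
entries between `A` and `n` can be chosen so that it is positive semidefinite on
`A ∪ B ∪ {n}`. -/
theorem exists_isPSDFamily_insert {ι G E : Type*} [DecidableEq ι] [Group G] [NormedAddCommGroup E]
    [InnerProductSpace ℂ E] [CompleteSpace E] {A B : Finset ι} {n : ι}
    (hnA : n ∉ A) (hnB : n ∉ B) (p : ι → ι → G → (E →L[ℂ] E))
    (hsymm₁ : ∀ j ∈ A ∪ B, ∀ k ∈ A ∪ B, ∀ g,
      p k j g = ContinuousLinearMap.adjoint (p j k g⁻¹))
    (hsymm₂ : ∀ j ∈ insert n B, ∀ k ∈ insert n B, ∀ g,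
      p k j g = ContinuousLinearMap.adjoint (p j k g⁻¹))
    (hpsd₁ : IsPSDFamily (↑(A ∪ B) : Set ι) p)
    (hpsd₂ : IsPSDFamily (↑(insert n B) : Set ι) p) :
    ∃ q : ι → G → (E →L[ℂ] E), IsPSDFamily (↑(insert n (A ∪ B)) : Set ι) fun j k =>
      if j ∈ A ∧ k = n then q j
      else if k ∈ A ∧ j = n then fun g => ContinuousLinearMap.adjoint (q k g⁻¹)
      else p j k := by
  rw [isPSDFamily_iff] at hpsd₁ hpsd₂
  have hn₂ : n ∈ insert n B := Finset.mem_insert_self n B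
  obtain ⟨τ, hτ, hτ_le, hτ_inv⟩ := exists_coupling (familyForm (A ∪ B) p)
    (familyForm (insert n B) p) (conj_familyForm hsymm₁) (fun φ => (hpsd₁ φ).1)
    (conj_familyForm hsymm₂) (fun φ => (hpsd₂ φ).1) (mask G E B)
    (fun φ ψ => by rw [familyForm_mask Finset.subset_union_right,
      familyForm_mask (Finset.subset_insert n B)])
  let t (j : ι) : (G →₀ E) →ₗ⋆[ℂ] (G →₀ E) →ₗ[ℂ] ℂ :=
    (τ.comp (LinearMap.single ℂ (fun _ => G →₀ E) j)).compl₂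
      (LinearMap.single ℂ (fun _ => G →₀ E) n)
  have ht : ∀ j u v, t j u v = τ (Pi.single j u) (Pi.single n v) := fun _ _ _ => rfl
  have ht_inv : ∀ j (g : G) u v,
      t j (u.mapDomain (g * ·)) (v.mapDomain (g * ·)) = t j u v := fun j g u v => by
    rw [ht, ← translateFamily_single, ← translateFamily_single]
    exact hτ_inv (translateFamily ι E g) (translateFamily_surjective g) (mask_translateFamily B g)
      (familyForm_translateFamily _ p g) (familyForm_translateFamily _ p g) _ _
  have sqrt_le : ∀ (P : G → E →L[ℂ] E) (g : G) (e : E),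
      √(convForm P (Finsupp.single g e) (Finsupp.single g e)).re ≤ √‖P 1‖ * ‖e‖ := fun P g e => by
    refine Real.sqrt_le_iff.2 ⟨by positivity, ?_⟩
    rw [mul_pow, Real.sq_sqrt (norm_nonneg _), convForm_single, inv_mul_cancel]
    refine (Complex.re_le_norm _).trans ((norm_inner_le_norm _ _).trans ?_)
    nlinarith [(P 1).le_opNorm e, norm_nonneg e]
  have hq : ∀ j, ∃ q : G → E →L[ℂ] E, j ∈ A → t j = convForm q := fun j => by
    by_cases hj : j ∈ A
    · have hj₁ : j ∈ A ∪ B := Finset.mem_union_left B hj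
      obtain ⟨q, hq⟩ := exists_eq_convForm (t j) (ht_inv j) fun g =>
        ⟨√‖p j j 1‖ * √‖p n n 1‖, fun e e' => by
          refine (hτ_le _ _).trans ?_
          simp only [LinearMap.coe_single, familyForm_single p hj₁ hj₁,
            familyForm_single p hn₂ hn₂]
          calc _ ≤ (√‖p j j 1‖ * ‖e‖) * (√‖p n n 1‖ * ‖e'‖) :=
                mul_le_mul (sqrt_le _ _ _) (sqrt_le _ _ _) (Real.sqrt_nonneg _) (by positivity)
            _ = _ := by ring⟩
      exact ⟨q, fun _ => hq⟩
    · exact ⟨0, fun h => absurd h hj⟩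
  choose q hq using hq
  refine ⟨q, (isPSDFamily_iff _ _).2 fun φ => ?_⟩
  set p' : ι → ι → G → (E →L[ℂ] E) := fun j k =>
    if j ∈ A ∧ k = n then q j
    else if k ∈ A ∧ j = n then fun g => ContinuousLinearMap.adjoint (q k g⁻¹)
    else p j k with hp'
  have hn : n ∉ A ∪ B := by simp [hnA, hnB]
  have ne_of_mem : ∀ j ∈ A ∪ B, j ≠ n := fun j hj h => hn (h ▸ hj)
  have hp'_nn : p' n n = p n n := by simp [hp', hnA]
  have hp'_union : ∀ j ∈ A ∪ B, ∀ k ∈ A ∪ B, p' j k = p j k := fun j hj k hk => by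
    simp [hp', ne_of_mem j hj, ne_of_mem k hk]
  have hp'_col : ∀ j ∈ A ∪ B, convForm (p' j n) = t j := fun j hj => by
    by_cases hjA : j ∈ A
    · rw [hq j hjA]
      simp [hp', hjA]
    · have hjB : j ∈ B := (Finset.mem_union.1 hj).resolve_left hjA
      have : p' j n = p j n := by simp [hp', hjA, hnA]
      refine LinearMap.ext₂ fun u v => ?_
      rw [ht, ← mask_single (G := G) (E := E) hjB, hτ, mask_single hjB,
        familyForm_single p (Finset.mem_insert_of_mem hjB) hn₂, this]
  have hp'_row : ∀ j ∈ A ∪ B, ∀ u v, convForm (p' n j) u v = starRingEnd ℂ (t j v u) :=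
    fun j hj u v => by
    rw [← hp'_col j hj, conj_convForm]
    congr 3
    funext g
    by_cases hjA : j ∈ A
    · simp [hp', hjA, hnA]
    · have hjB : j ∈ B := (Finset.mem_union.1 hj).resolve_left hjA
      simpa [hp', hjA, hnA] using hsymm₂ j (Finset.mem_insert_of_mem hjB) n hn₂ g
  have hτ_sum : τ (mask G E (A ∪ B) φ) (Pi.single n (φ n)) =
      ∑ j ∈ A ∪ B, t j (φ j) (φ n) := by
    simp [mask_eq_sum, LinearMap.sum_apply, ht]
  have key : familyForm (insert n (A ∪ B)) p' φ φ =
      convForm (p n n) (φ n) (φ n) + starRingEnd ℂ (τ (mask G E (A ∪ B) φ) (Pi.single n (φ n))) +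
        τ (mask G E (A ∪ B) φ) (Pi.single n (φ n)) + familyForm (A ∪ B) p φ φ := by
    rw [familyForm_apply, Finset.sum_insert hn, Finset.sum_insert hn, hp'_nn, add_assoc _ (τ _ _)]
    congr 1
    · rw [hτ_sum, map_sum]
      exact congrArg _ (Finset.sum_congr rfl fun j hj => hp'_row j hj _ _)
    · rw [hτ_sum, familyForm_apply, ← Finset.sum_add_distrib]
      refine Finset.sum_congr rfl fun j hj => ?_
      rw [Finset.sum_insert hn, hp'_col j hj]
      exact congrArg _ (Finset.sum_congr rfl fun k hk => by rw [hp'_union j hj k hk])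
  have hle := hτ_le (mask G E (A ∪ B) φ) (Pi.single n (φ n))
  have hnn := hpsd₂ (Pi.single n (φ n))
  rw [familyForm_single p hn₂ hn₂] at hle hnn
  rw [familyForm_mask subset_rfl] at hle
  have hu := hpsd₁ φ
  have hre := (abs_le.1 (Complex.abs_re_le_norm
    (τ (mask G E (A ∪ B) φ) (Pi.single n (φ n))))).1
  rw [key]
  simp only [Complex.add_re, Complex.add_im, Complex.conj_re, Complex.conj_im, hnn.2, hu.2]
  refine ⟨?_, by ring⟩
  nlinarith [sq_nonneg (√(familyForm (A ∪ B) p φ φ).re - √(convForm (p n n) (φ n) (φ n)).re),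
    Real.sq_sqrt hu.1, Real.sq_sqrt hnn.1]

/-- Iterated Parrott completion for psd functions on a group. -/
theorem stmt7
    (G : Type) [Group G]
    (E : Type) [NormedAddCommGroup E] [InnerProductSpace ℂ E] [CompleteSpace E]
    (M N : ℕ) (hM : 0 < M) (hN : 0 < N)
    (p : ℤ → ℤ → G → (E →L[ℂ] E))
    (hsym : ∀ j k : ℤ, j ∈ Set.Icc (-(M : ℤ)) (N : ℤ) → k ∈ Set.Icc (-(M : ℤ)) (N : ℤ) →
      ¬(j ∈ Set.Icc (-(M : ℤ)) 0 ∧ k = (N : ℤ)) →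
      ¬(k ∈ Set.Icc (-(M : ℤ)) 0 ∧ j = (N : ℤ)) →
      ∀ g : G, p k j g = ContinuousLinearMap.adjoint (p j k g⁻¹))
    (hP : IsPSDFamily (Set.Icc (-(M : ℤ)) ((N : ℤ) - 1)) p)
    (hQ : IsPSDFamily (Set.Icc 1 (N : ℤ)) p) :
    ∃ q : ℤ → G → (E →L[ℂ] E), ∃ p' : ℤ → ℤ → G → (E →L[ℂ] E),
      (∀ j k : ℤ, ¬(j ∈ Set.Icc (-(M : ℤ)) 0 ∧ k = (N : ℤ)) →
        ¬(k ∈ Set.Icc (-(M : ℤ)) 0 ∧ j = (N : ℤ)) → p' j k = p j k) ∧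
      (∀ j ∈ Set.Icc (-(M : ℤ)) 0, p' j (N : ℤ) = q j) ∧
      (∀ j ∈ Set.Icc (-(M : ℤ)) 0, ∀ g : G,
        p' (N : ℤ) j g = ContinuousLinearMap.adjoint (q j g⁻¹)) ∧
      IsPSDFamily (Set.Icc (-(M : ℤ)) (N : ℤ)) p' := by
  have hAB : Finset.Icc (-(M : ℤ)) 0 ∪ Finset.Icc 1 ((N : ℤ) - 1) =
      Finset.Icc (-(M : ℤ)) ((N : ℤ) - 1) := by
    ext j
    simp only [Finset.mem_union, Finset.mem_Icc]
    omega
  have hBN : insert (N : ℤ) (Finset.Icc 1 ((N : ℤ) - 1)) = Finset.Icc 1 (N : ℤ) := by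
    ext j
    simp only [Finset.mem_insert, Finset.mem_Icc]
    omega
  have hall : insert (N : ℤ) (Finset.Icc (-(M : ℤ)) ((N : ℤ) - 1)) =
      Finset.Icc (-(M : ℤ)) (N : ℤ) := by
    ext j
    simp only [Finset.mem_insert, Finset.mem_Icc]
    omega
  have hNA : (N : ℤ) ∉ Finset.Icc (-(M : ℤ)) 0 := by simp [hN.ne']
  obtain ⟨q, hq⟩ := exists_isPSDFamily_insert (B := Finset.Icc 1 ((N : ℤ) - 1)) hNA (by simp) p
    (fun j hj k hk g => by
      rw [hAB, Finset.mem_Icc] at hj hk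
      refine hsym j k ⟨hj.1, by omega⟩ ⟨hk.1, by omega⟩ ?_ ?_ g <;> rintro ⟨-, h⟩ <;> omega)
    (fun j hj k hk g => by
      rw [hBN, Finset.mem_Icc] at hj hk
      refine hsym j k ⟨by omega, hj.2⟩ ⟨by omega, hk.2⟩ ?_ ?_ g <;> rintro ⟨⟨-, h⟩, -⟩ <;> omega)
    (by rwa [hAB, Finset.coe_Icc]) (by rwa [hBN, Finset.coe_Icc])
  rw [hAB, hall, Finset.coe_Icc] at hq
  simp only [← Finset.coe_Icc, Finset.mem_coe] at hq ⊢
  refine ⟨q, _, fun j k hjk hkj => ?_, fun j hj => ?_, fun j hj g => ?_, hq⟩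
  · rw [if_neg hjk, if_neg hkj]
  · rw [if_pos ⟨hj, rfl⟩]
  · rw [if_neg fun h => hNA h.1, if_pos ⟨hj, rfl⟩]
end

section
/- Let G be a group, E a complex Hilbert space, F a finite set, s₀ ∈ F, and F₀ a proper subset of F ∖ {s₀}. Suppose functions p_{s,t} : G → B(E) are given for all pairs (s,t) ∈ F×F ∖ (({s₀}×F₀) ∪ (F₀×{s₀})), satisfying p_{t,s}(g) = (p_{s,t}(g⁻¹))* for all such pairs and all g ∈ G. If the families (p_{s,t}) indexed by (F∖{s₀})² and by (F∖F₀)² are both positive semidefinite, then there exist functions p_{s₀,t} : G → B(E) for t ∈ F₀ such that, setting p_{t,s₀}(g) = (p_{s₀,t}(g⁻¹))*, the full family (p_{s,t}) indexed by F×F is positive semidefinite. -/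
open scoped ComplexInnerProductSpace

/-- The `G`-double sum of a translation-invariant kernel that factors through a Hilbert space is
an inner product. -/
lemma finsum_finsum_inner_eq {G E H : Type*} [Group G]
    [NormedAddCommGroup E] [InnerProductSpace ℂ E] [NormedAddCommGroup H] [InnerProductSpace ℂ H]
    (r : G → (E →L[ℂ] E)) (D D' : G → (E →L[ℂ] H))
    (h : ∀ a b e f, ⟪D a e, D' b f⟫ = ⟪e, r (a⁻¹ * b) f⟫) (φ ψ : G →₀ E) :
    ∑ᶠ a : G, ∑ᶠ b : G, ⟪φ a, r (a⁻¹ * b) (ψ b)⟫ =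
      ⟪φ.sum fun a e => D a e, ψ.sum fun b f => D' b f⟫ := by
  rw [finsum_eq_sum_of_support_subset (s := φ.support), Finsupp.sum, sum_inner]
  · refine Finset.sum_congr rfl fun a _ => ?_
    rw [finsum_eq_sum_of_support_subset (s := ψ.support), Finsupp.sum, inner_sum]
    · exact Finset.sum_congr rfl fun b _ => (h _ _ _ _).symm
    · intro b hb
      contrapose! hb
      simp_all
  · intro a ha
    contrapose! ha
    simp_all

section Contraction

variable {N H₁ H₂ : Type*} [AddCommGroup N] [Module ℂ N]
  [NormedAddCommGroup H₁] [InnerProductSpace ℂ H₁]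
  [NormedAddCommGroup H₂] [InnerProductSpace ℂ H₂]

/-- An element of the closed range of `L` is determined by its inner products with that range. -/
lemma eq_of_mem_closure_range_of_inner_eq (L : N →ₗ[ℂ] H₁) {u v : H₁}
    (hu : u ∈ (LinearMap.range L).topologicalClosure)
    (hv : v ∈ (LinearMap.range L).topologicalClosure)
    (h : ∀ n, ⟪u, L n⟫ = ⟪v, L n⟫) : u = v := by
  have hsub : u - v ∈ (LinearMap.range L).topologicalClosure := sub_mem hu hv
  have hperp : u - v ∈ (LinearMap.range L)ᗮ := by
    rw [Submodule.mem_orthogonal']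
    rintro _ ⟨n, rfl⟩
    rw [inner_sub_left, h n, sub_self]
  rw [← Submodule.orthogonal_closure] at hperp
  exact sub_eq_zero.1 (inner_self_eq_zero.1 (Submodule.inner_right_of_mem_orthogonal hsub hperp))

variable [CompleteSpace H₁]

/-- Two linear maps with the same Gram form are intertwined by a contraction, namely the adjoint
of the partial isometry carrying the closed range of one onto that of the other. -/
lemma exists_contraction_of_inner_eq [CompleteSpace H₂] (L₁ : N →ₗ[ℂ] H₁) (L₂ : N →ₗ[ℂ] H₂)
    (h : ∀ n m, ⟪L₁ n, L₁ m⟫ = ⟪L₂ n, L₂ m⟫) :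
    ∃ C : H₂ →L[ℂ] H₁, (∀ y, ‖C y‖ ≤ ‖y‖) ∧
      (∀ y, C y ∈ (LinearMap.range L₁).topologicalClosure) ∧
      ∀ y n, ⟪C y, L₁ n⟫ = ⟪y, L₂ n⟫ := by
  set K := (LinearMap.range L₁).topologicalClosure with hK
  have hle : LinearMap.range L₁ ≤ K := Submodule.le_topologicalClosure _
  have : CompleteSpace K := (Submodule.isClosed_topologicalClosure _).completeSpace_coe
  let e : N →ₗ[ℂ] K := (Submodule.inclusion hle).comp L₁.rangeRestrict
  have he : DenseRange e := by
    have h1 : DenseRange (Submodule.inclusion hle) :=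
      denseRange_inclusion_iff (s := (LinearMap.range L₁ : Set H₁)) (t := (K : Set H₁)) hle |>.2
        (by rw [hK, Submodule.topologicalClosure_coe])
    exact h1.comp L₁.surjective_rangeRestrict.denseRange
      (continuous_inclusion (s := (LinearMap.range L₁ : Set H₁)) (t := (K : Set H₁)) hle)
  have hnorm : ∀ n, ‖L₂ n‖ ≤ 1 * ‖e n‖ := fun n => by
    have h1 : ‖e n‖ = ‖L₁ n‖ := rfl
    rw [one_mul, h1, @norm_eq_sqrt_re_inner ℂ _ _ _ _ (L₁ n),
      @norm_eq_sqrt_re_inner ℂ _ _ _ _ (L₂ n), h]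
  let R : K →L[ℂ] H₂ := L₂.extendOfNorm e
  have hR : ∀ n, R (e n) = L₂ n := LinearMap.extendOfNorm_eq he ⟨1, hnorm⟩
  have hR1 : ‖R‖ ≤ 1 := LinearMap.opNorm_extendOfNorm_le he zero_le_one hnorm
  refine ⟨K.subtypeL ∘L R.adjoint, fun y => ?_, fun y => ?_, fun y n => ?_⟩
  · calc ‖R.adjoint y‖ ≤ ‖R.adjoint‖ * ‖y‖ := R.adjoint.le_opNorm y
      _ ≤ 1 * ‖y‖ := by
        gcongr
        rwa [LinearIsometryEquiv.norm_map]
      _ = ‖y‖ := one_mul _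
  · exact (R.adjoint y).2
  · change ⟪R.adjoint y, e n⟫ = _
    rw [ContinuousLinearMap.adjoint_inner_left, hR]

/-- Invariance of an inner product under a Gram-form preserving automorphism `T`, when one of
the vectors lies in the closed range of `L`. -/
lemma inner_eq_of_inner_eq_of_mem_closure_range (L : N →ₗ[ℂ] H₁) (T : N ≃ₗ[ℂ] N)
    (hT : ∀ n m, ⟪L (T n), L (T m)⟫ = ⟪L n, L m⟫) {u u' x x' : H₁}
    (hu : u ∈ (LinearMap.range L).topologicalClosure)
    (hu' : u' ∈ (LinearMap.range L).topologicalClosure)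
    (h : ∀ n, ⟪u', L (T n)⟫ = ⟪u, L n⟫) (hx : ∀ n, ⟪x', L (T n)⟫ = ⟪x, L n⟫) :
    ⟪x', u'⟫ = ⟪x, u⟫ := by
  set LT : N →ₗ[ℂ] H₁ := L.comp (T : N →ₗ[ℂ] N) with hLT
  have hrange : LinearMap.range LT = LinearMap.range L :=
    LinearMap.range_comp_of_range_eq_top L (LinearEquiv.range T)
  obtain ⟨C, -, hCmem, hC⟩ := exists_contraction_of_inner_eq LT L hT
  have hCu : C u = u' := by
    refine eq_of_mem_closure_range_of_inner_eq LT (hCmem u) (hrange ▸ hu') fun n => ?_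
    rw [hC, ← h]
    rfl
  have hCL : ∀ n, C (L n) = LT n := fun n =>
    eq_of_mem_closure_range_of_inner_eq LT (hCmem _)
      (Submodule.le_topologicalClosure _ ⟨n, rfl⟩) fun m => by
        rw [hC]
        exact (hT n m).symm
  have hker : (LinearMap.range L).topologicalClosure ≤
      LinearMap.ker ((innerSL ℂ x' ∘L C - innerSL ℂ x : H₁ →L[ℂ] ℂ) : H₁ →ₗ[ℂ] ℂ) := by
    refine Submodule.topologicalClosure_minimal _ ?_ (ContinuousLinearMap.isClosed_ker _)
    rintro _ ⟨n, rfl⟩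
    simpa [hCL, hLT, sub_eq_zero] using hx n
  have := hker hu
  simpa [hCu, sub_eq_zero] using this

end Contraction

section Synthesis

variable {X E H₁ H₂ : Type*} [NormedAddCommGroup E] [NormedSpace ℂ E]
  [NormedAddCommGroup H₁] [InnerProductSpace ℂ H₁]
  [NormedAddCommGroup H₂] [InnerProductSpace ℂ H₂]

/-- The linear map on finitely supported families assembled from the operators `D x`. -/
noncomputable def synthesis (D : X → (E →L[ℂ] H₁)) : (X →₀ E) →ₗ[ℂ] H₁ :=
  Finsupp.lsum ℂ fun x => (D x : E →ₗ[ℂ] H₁)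

@[simp]
lemma synthesis_single (D : X → (E →L[ℂ] H₁)) (x : X) (e : E) :
    synthesis D (Finsupp.single x e) = D x e := by
  simp [synthesis]

lemma synthesis_domLCongr (D : X → (E →L[ℂ] H₁)) (σ : X ≃ X) (n : X →₀ E) :
    synthesis D (Finsupp.domLCongr (R := ℂ) σ n) = synthesis (fun x => D (σ x)) n := by
  induction n using Finsupp.induction_linear with
  | zero => simp
  | add n m hn hm => simp only [map_add, hn, hm]
  | single x e => simp

lemma inner_synthesis_eq {D : X → (E →L[ℂ] H₁)} {D' : X → (E →L[ℂ] H₂)} {u : H₁} {v : H₂}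
    (h : ∀ x e, ⟪u, D x e⟫ = ⟪v, D' x e⟫) (n : X →₀ E) :
    ⟪u, synthesis D n⟫ = ⟪v, synthesis D' n⟫ := by
  induction n using Finsupp.induction_linear with
  | zero => simp
  | add n m hn hm => simp only [map_add, inner_add_right, hn, hm]
  | single x e => simpa using h x e

lemma inner_synthesis_synthesis_eq {D : X → (E →L[ℂ] H₁)} {D' : X → (E →L[ℂ] H₂)}
    (h : ∀ x e y f, ⟪D x e, D y f⟫ = ⟪D' x e, D' y f⟫) (n m : X →₀ E) :
    ⟪synthesis D n, synthesis D m⟫ = ⟪synthesis D' n, synthesis D' m⟫ := by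
  refine inner_synthesis_eq (fun y f => ?_) m
  rw [← inner_conj_symm, ← inner_conj_symm (synthesis D' n),
    inner_synthesis_eq fun x e => h y f x e]

end Synthesis

/-- Kolmogorov decomposition of a positive semidefinite family. -/
lemma IsPSDFamily.exists_kolmogorov.{u, v, w} {ι : Type u} {G : Type v} {E : Type w} [Group G]
    [NormedAddCommGroup E] [InnerProductSpace ℂ E] [CompleteSpace E]
    {J : Set ι} (hJ : J.Finite) {p : ι → ι → G → (E →L[ℂ] E)} (hp : IsPSDFamily J p)
    (hsym : ∀ j ∈ J, ∀ k ∈ J, ∀ g, p k j g = ContinuousLinearMap.adjoint (p j k g⁻¹)) :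
    ∃ (H : Type (max u v w)) (_ : NormedAddCommGroup H) (_ : InnerProductSpace ℂ H)
      (_ : CompleteSpace H) (D : ι → G → (E →L[ℂ] H)), ∀ j ∈ J, ∀ k ∈ J, ∀ g h e f,
        ⟪D j g e, D k h f⟫ = ⟪e, p j k (g⁻¹ * h) f⟫ := by
  classical
  have := hJ.fintype
  let K : Matrix (J × G) (J × G) (E →L[ℂ] E) := .of fun x y => p x.1 y.1 (x.2⁻¹ * y.2)
  have hK : K.PosSemidef := by
    have htfae := (RKHS.posSemidef_tfae (K := K)).out 0 2
    refine htfae.2 ⟨?_, fun vv => ?_⟩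
    · ext1 x y
      change star (p y.1 x.1 (y.2⁻¹ * x.2)) = p x.1 y.1 (x.2⁻¹ * y.2)
      rw [ContinuousLinearMap.star_eq_adjoint, hsym y.1 y.1.2 x.1 x.1.2]
      simp
    · set φ : ι → G →₀ E := fun j => if hj : j ∈ J then vv.curry ⟨j, hj⟩ else 0 with hφ
      have hφ_apply : ∀ (j : J) g, φ j g = vv (j, g) := fun j g => by
        simp [hφ, Finsupp.curry_apply]
      let T : Finset G := vv.support.image Prod.snd
      have hT : ∀ x g, vv (x, g) ≠ 0 → g ∈ T := fun x g hx =>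
        Finset.mem_image.2 ⟨(x, g), Finsupp.mem_support_iff.2 hx, rfl⟩
      have hsub : vv.support ⊆ Finset.univ ×ˢ T := fun x hx =>
        Finset.mem_product.2 ⟨Finset.mem_univ _, hT x.1 x.2 (Finsupp.mem_support_iff.1 hx)⟩
      have hvv : ∀ f : J × G → E → ℂ, (∀ x, f x 0 = 0) →
          vv.sum f = ∑ x ∈ Finset.univ ×ˢ T, f x (vv x) := fun f hf =>
        Finsupp.sum_of_support_subset _ hsub _ fun x _ => hf x
      have hG : ∀ f : G → ℂ, (∀ g ∉ T, f g = 0) → ∑ᶠ g, f g = ∑ g ∈ T, f g := fun f hf =>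
        finsum_eq_sum_of_support_subset f fun g hg => by
          contrapose! hg
          simpa using hf g hg
      have hzero : ∀ (j : J), ∀ g ∉ T, φ j g = 0 := fun j g hg => by
        rw [hφ_apply]
        contrapose! hg
        exact hT j g hg
      have key : ∑ᶠ j ∈ J, ∑ᶠ k ∈ J, ∑ᶠ g : G, ∑ᶠ h : G, ⟪φ j g, p j k (g⁻¹ * h) (φ k h)⟫ =
          ∑ x ∈ Finset.univ ×ˢ T, ∑ y ∈ Finset.univ ×ˢ T, ⟪vv x, K x y (vv y)⟫ := by
        simp only [Finset.sum_product]
        simp_rw [← finsum_set_coe_eq_finsum_mem, finsum_eq_sum_of_fintype]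
        refine Finset.sum_congr rfl fun j _ => ?_
        rw [Finset.sum_comm]
        refine Finset.sum_congr rfl fun k _ => ?_
        rw [hG _ fun g hg => by simp [hzero j g hg]]
        refine Finset.sum_congr rfl fun g _ => ?_
        rw [hG _ fun h hh => by simp [hzero k h hh]]
        simp [hφ_apply, K]
      have hconj : starRingEnd ℂ (vv.sum fun x w => vv.sum fun x' w' => ⟪K x' x w, w'⟫) =
          ∑ x ∈ Finset.univ ×ˢ T, ∑ y ∈ Finset.univ ×ˢ T, ⟪vv x, K x y (vv y)⟫ := by
        rw [hvv _ fun x => by simp,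
          Finset.sum_congr rfl fun x _ => hvv (fun x' w' => ⟪K x' x (vv x), w'⟫) fun x' => by simp]
        simp only [map_sum, inner_conj_symm]
        exact Finset.sum_comm
      have h := (hp φ).1
      rw [key, ← hconj] at h
      simpa using h
  have : Fact K.PosSemidef := ⟨hK⟩
  refine ⟨RKHS.OfKernel K, inferInstance, inferInstance, inferInstance,
    fun j g => if hj : j ∈ J then RKHS.kerFun (RKHS.OfKernel K) (⟨j, hj⟩, g) else 0, ?_⟩
  intro j hj k hk g h e f
  simp only [dif_pos hj, dif_pos hk]
  rw [RKHS.kerFun_inner, RKHS.kerFun_apply, RKHS.OfKernel.kernel_ofKernel]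
  rfl

/-- Parrott-type psd completion, general index sets. -/
theorem stmt8
    (G : Type) [Group G]
    (E : Type) [NormedAddCommGroup E] [InnerProductSpace ℂ E] [CompleteSpace E]
    (ι : Type) (S : Set ι) (hS : S.Finite) (s₀ : ι) (hs₀ : s₀ ∈ S)
    (F₀ : Set ι) (hF₀ : F₀ ⊂ S \ {s₀})
    (p : ι → ι → G → (E →L[ℂ] E))
    (hsym : ∀ s t : ι, s ∈ S → t ∈ S →
      ¬(s = s₀ ∧ t ∈ F₀) → ¬(t = s₀ ∧ s ∈ F₀) →
      ∀ g : G, p t s g = ContinuousLinearMap.adjoint (p s t g⁻¹))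
    (hP : IsPSDFamily (S \ {s₀}) p)
    (hQ : IsPSDFamily (S \ F₀) p) :
    ∃ q : ι → G → (E →L[ℂ] E), ∃ p' : ι → ι → G → (E →L[ℂ] E),
      (∀ s t : ι, ¬(s = s₀ ∧ t ∈ F₀) → ¬(t = s₀ ∧ s ∈ F₀) → p' s t = p s t) ∧
      (∀ t ∈ F₀, p' s₀ t = q t) ∧
      (∀ t ∈ F₀, ∀ g : G, p' t s₀ g = ContinuousLinearMap.adjoint (q t g⁻¹)) ∧
      IsPSDFamily S p' := by
  classical
  have hs₀F₀ : s₀ ∉ F₀ := fun h => (hF₀.1 h).2 rfl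
  obtain ⟨H₁, _, _, _, D₁, hD₁⟩ := hP.exists_kolmogorov (hS.subset Set.sdiff_subset)
    fun j hj k hk => hsym j k hj.1 hk.1 (fun h => hj.2 h.1) (fun h => hk.2 h.1)
  obtain ⟨H₂, _, _, _, D₂, hD₂⟩ := hQ.exists_kolmogorov (hS.subset Set.sdiff_subset)
    fun j hj k hk => hsym j k hj.1 hk.1 (fun h => hk.2 h.2) (fun h => hj.2 h.2)
  have hs₀Q : s₀ ∈ S \ F₀ := ⟨hs₀, hs₀F₀⟩
  let B : Set ι := (S \ {s₀}) \ F₀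
  have hBP : ∀ b : B, (b : ι) ∈ S \ {s₀} := fun b => b.2.1
  have hBQ : ∀ b : B, (b : ι) ∈ S \ F₀ := fun b => ⟨b.2.1.1, b.2.2⟩
  let Δ₁ : B × G → (E →L[ℂ] H₁) := fun x => D₁ x.1 x.2
  let Δ₂ : B × G → (E →L[ℂ] H₂) := fun x => D₂ x.1 x.2
  obtain ⟨C, hCle, hCmem, hC⟩ := exists_contraction_of_inner_eq (synthesis Δ₁) (synthesis Δ₂)
    (inner_synthesis_synthesis_eq fun x e y f => by
      rw [hD₁ _ (hBP x.1) _ (hBP y.1), hD₂ _ (hBQ x.1) _ (hBQ y.1)])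
  have hCB : ∀ b ∈ B, ∀ y g e, ⟪C y, D₁ b g e⟫ = ⟪y, D₂ b g e⟫ := fun b hb y g e => by
    simpa [Δ₁, Δ₂] using hC y (Finsupp.single (⟨b, hb⟩, g) e)
  have hinv : ∀ t ∈ F₀, ∀ g h e f,
      ⟪C (D₂ s₀ g e), D₁ t h f⟫ = ⟪C (D₂ s₀ 1 e), D₁ t (g⁻¹ * h) f⟫ := by
    intro t ht g h e f
    have htP := hF₀.1 ht
    let σ : B × G ≃ B × G := (Equiv.refl B).prodCongr (Equiv.mulLeft g)
    rw [← inner_conj_symm, ← inner_conj_symm (C (D₂ s₀ 1 e))]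
    congr 1
    refine inner_eq_of_inner_eq_of_mem_closure_range (synthesis Δ₁)
      (Finsupp.domLCongr (R := ℂ) σ) (fun n m => ?_) (hCmem _) (hCmem _) (fun n => ?_)
      (fun n => ?_)
    · simp only [synthesis_domLCongr]
      refine inner_synthesis_synthesis_eq (fun x a y b => ?_) n m
      rw [hD₁ _ (hBP _) _ (hBP _), hD₁ _ (hBP _) _ (hBP _)]
      simp [σ, mul_assoc]
    · rw [hC, hC, synthesis_domLCongr]
      refine inner_synthesis_eq (fun x a => ?_) n
      rw [hD₂ _ hs₀Q _ (hBQ _), hD₂ _ hs₀Q _ (hBQ _)]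
      simp [σ]
    · rw [synthesis_domLCongr]
      refine inner_synthesis_eq (fun x a => ?_) n
      rw [hD₁ _ htP _ (hBP _), hD₁ _ htP _ (hBP _)]
      simp [σ, mul_assoc]
  let q : ι → G → (E →L[ℂ] E) := fun t g =>
    ContinuousLinearMap.adjoint (C ∘L D₂ s₀ 1) ∘L D₁ t g
  let p' : ι → ι → G → (E →L[ℂ] E) := fun s t g =>
    if s = s₀ ∧ t ∈ F₀ then q t g
    else if t = s₀ ∧ s ∈ F₀ then ContinuousLinearMap.adjoint (q s g⁻¹) else p s t g
  have hp' : ∀ s t : ι, ¬(s = s₀ ∧ t ∈ F₀) → ¬(t = s₀ ∧ s ∈ F₀) → p' s t = p s t :=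
    fun s t h h' => by simp only [p', if_neg h, if_neg h']
  have hp'q : ∀ t ∈ F₀, p' s₀ t = q t := fun t ht => by simp [p', ht]
  have hp'q' : ∀ t ∈ F₀, ∀ g, p' t s₀ g = ContinuousLinearMap.adjoint (q t g⁻¹) :=
    fun t ht g => by simp [p', ht, hs₀F₀]
  refine ⟨q, p', hp', hp'q, hp'q', fun φ => ?_⟩
  have hrow : ∀ k ∈ S \ {s₀}, ∀ g h e f,
      ⟪(C ∘L D₂ s₀ g) e, D₁ k h f⟫ = ⟪e, p' s₀ k (g⁻¹ * h) f⟫ := by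
    intro k hk g h e f
    by_cases hkF : k ∈ F₀
    · rw [hp'q k hkF, ContinuousLinearMap.comp_apply, hinv k hkF]
      change _ = ⟪e, ContinuousLinearMap.adjoint (C ∘L D₂ s₀ 1) (D₁ k (g⁻¹ * h) f)⟫
      rw [ContinuousLinearMap.adjoint_inner_right, ContinuousLinearMap.comp_apply]
    · rw [hp' _ _ (fun h => hkF h.2) (fun h => hk.2 h.1), ContinuousLinearMap.comp_apply,
        hCB k ⟨hk, hkF⟩, hD₂ _ hs₀Q _ ⟨hk.1, hkF⟩]
  have hadj : ∀ k ∈ S \ {s₀}, ∀ g, p' k s₀ g = ContinuousLinearMap.adjoint (p' s₀ k g⁻¹) := by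
    intro k hk g
    by_cases hkF : k ∈ F₀
    · rw [hp'q k hkF, hp'q' k hkF]
    · rw [hp' _ _ (fun h => hk.2 h.1) (fun h => hkF h.2),
        hp' _ _ (fun h => hkF h.2) (fun h => hk.2 h.1),
        hsym s₀ k hs₀ hk.1 (fun h => hkF h.2) (fun h => hk.2 h.1)]
  have hcol : ∀ j ∈ S \ {s₀}, ∀ g h e f,
      ⟪D₁ j g e, (C ∘L D₂ s₀ h) f⟫ = ⟪e, p' j s₀ (g⁻¹ * h) f⟫ := by
    intro j hj g h e f
    rw [hadj j hj, ContinuousLinearMap.adjoint_inner_right, ← inner_conj_symm, hrow j hj,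
      inner_conj_symm, mul_inv_rev, inv_inv]
  let x : ι → H₁ := fun j => (φ j).sum fun g e => D₁ j g e
  let y : H₂ := (φ s₀).sum fun g e => D₂ s₀ g e
  have hCy : C y = (φ s₀).sum fun g e => (C ∘L D₂ s₀ g) e := map_finsuppSum C _ _
  let T : Finset ι := (hS.subset (Set.sdiff_subset (t := {s₀}))).toFinset
  have hT : ∀ j, j ∈ T ↔ j ∈ S \ {s₀} := fun j => Set.Finite.mem_toFinset _
  have hST : S = ↑(insert s₀ T) := by
    ext j
    by_cases hj : j = s₀ <;> simp [hT, hj, hs₀]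
  have hs₀T : s₀ ∉ T := by simp [hT]
  let X : ι → ι → ℂ := fun j k => ∑ᶠ g : G, ∑ᶠ h : G, ⟪φ j g, p' j k (g⁻¹ * h) (φ k h)⟫
  have h₀₀ : X s₀ s₀ = ⟪y, y⟫ := finsum_finsum_inner_eq _ _ _ (fun g h e f => by
    rw [hp' _ _ (fun h => hs₀F₀ h.2) (fun h => hs₀F₀ h.2), hD₂ _ hs₀Q _ hs₀Q]) _ _
  have h₀ : ∀ k ∈ T, X s₀ k = ⟪C y, x k⟫ := fun k hk => by
    rw [hCy]
    exact finsum_finsum_inner_eq _ _ _ (hrow k ((hT k).1 hk)) _ _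
  have h₁ : ∀ j ∈ T, X j s₀ = ⟪x j, C y⟫ := fun j hj => by
    rw [hCy]
    exact finsum_finsum_inner_eq _ _ _ (hcol j ((hT j).1 hj)) _ _
  have h₂ : ∀ j ∈ T, ∀ k ∈ T, X j k = ⟪x j, x k⟫ := fun j hj k hk => by
    rw [hT] at hj hk
    refine finsum_finsum_inner_eq _ _ _ (fun g h e f => ?_) _ _
    rw [hp' _ _ (fun h => hj.2 h.1) (fun h => hk.2 h.1), hD₁ _ hj _ hk]
  have hsum : ∑ᶠ j ∈ S, ∑ᶠ k ∈ S, X j k =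
      ((‖(∑ j ∈ T, x j) + C y‖ ^ 2 + (‖y‖ ^ 2 - ‖C y‖ ^ 2) : ℝ) : ℂ) := by
    rw [hST]
    simp only [finsum_mem_coe_finset, Finset.sum_insert hs₀T, Finset.sum_add_distrib]
    rw [h₀₀, Finset.sum_congr rfl h₀, Finset.sum_congr rfl h₁,
      Finset.sum_congr rfl fun j hj => Finset.sum_congr rfl (h₂ j hj)]
    simp only [← inner_sum, ← sum_inner]
    push_cast
    simp only [← inner_self_eq_norm_sq_to_K (𝕜 := ℂ), ← Complex.coe_algebraMap,
      inner_add_left, inner_add_right]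
    ring
  change 0 ≤ (∑ᶠ j ∈ S, ∑ᶠ k ∈ S, X j k).re ∧ (∑ᶠ j ∈ S, ∑ᶠ k ∈ S, X j k).im = 0
  rw [hsum, Complex.ofReal_re, Complex.ofReal_im]
  have := pow_le_pow_left₀ (norm_nonneg _) (hCle y) 2
  exact ⟨by nlinarith [sq_nonneg ‖(∑ j ∈ T, x j) + C y‖], rfl⟩
end

section
/- Let G be a group and M ⊆ G a submonoid such that every element of G can be written as u⁻¹v with u, v ∈ M. Then for every finite subset S of G there exists d ∈ M such that d·s ∈ M for every s ∈ S. -/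
/-- If `M` is a submonoid of a group `G` with `G = {u⁻¹v : u, v ∈ M}`, then every
finite subset of `G` can be translated into `M` by a single left multiplication
by an element of `M`. -/
theorem stmt9
    (G : Type*) [Group G] (M : Submonoid G)
    (hM : ∀ γ : G, ∃ u ∈ M, ∃ v ∈ M, u⁻¹ * v = γ)
    (S : Set G) (hS : S.Finite) :
    ∃ d ∈ M, ∀ s ∈ S, d * s ∈ M := by
  induction S, hS using Set.Finite.induction_on with
  | empty => exact ⟨1, M.one_mem, by simp⟩
  | @insert a T _ _ ih =>
    obtain ⟨d, hd, hdT⟩ := ih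
    obtain ⟨u, hu, v, hv, huv⟩ := hM (d * a)
    refine ⟨u * d, M.mul_mem hu hd, ?_⟩
    rintro s (rfl | hs)
    · rwa [mul_assoc, ← huv, mul_inv_cancel_left]
    · rw [mul_assoc]
      exact M.mul_mem hu (hdT s hs)
end

section
/- Let G be a group, M ⊆ G a submonoid with G = {u⁻¹v : u, v ∈ M}, E a complex Hilbert space, N a positive integer, and p_{j,k} : G → B(E) functions for 1 ≤ j, k ≤ N. If the family (p_{j,k})_{1≤j,k≤N} is positive semidefinite over M, then it is positive semidefinite over G. -/
open scoped ComplexInnerProductSpace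

/-- A family of functions `p j k : G → B(E)` (`j, k ∈ J`) is positive semidefinite
over a subset `S` of `G`: for all finitely supported `φ_j : G → E` supported in `S`,
the associated form (with sums over `S`) is real and nonnegative. -/
def PSDoverFam {ι : Type*} {G : Type*} [Group G] {E : Type*}
    [NormedAddCommGroup E] [InnerProductSpace ℂ E]
    (S : Set G) (J : Set ι) (p : ι → ι → G → (E →L[ℂ] E)) : Prop :=
  ∀ φ : ι → G →₀ E, (∀ j : ι, ((φ j).support : Set G) ⊆ S) →
    0 ≤ (∑ᶠ j ∈ J, ∑ᶠ k ∈ J, ∑ᶠ g ∈ S, ∑ᶠ h ∈ S,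
          ⟪φ j g, p j k (g⁻¹ * h) (φ k h)⟫).re ∧
    (∑ᶠ j ∈ J, ∑ᶠ k ∈ J, ∑ᶠ g ∈ S, ∑ᶠ h ∈ S,
          ⟪φ j g, p j k (g⁻¹ * h) (φ k h)⟫).im = 0

/-- If every element of a group is a left quotient `u⁻¹ * v` of elements of a submonoid `M`, then
every finite subset has a left translate contained in `M`. -/
theorem Submonoid.exists_forall_mul_mem_of_finset {G : Type*} [Group G] (M : Submonoid G)
    (hM : ∀ γ : G, ∃ u ∈ M, ∃ v ∈ M, u⁻¹ * v = γ) (F : Finset G) :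
    ∃ x : G, ∀ g ∈ F, x * g ∈ M := by
  classical
  induction F using Finset.induction_on with
  | empty => exact ⟨1, by simp⟩
  | insert a s _ ih =>
    obtain ⟨x, hx⟩ := ih
    obtain ⟨u, hu, v, hv, huv⟩ := hM (x * a)
    refine ⟨u * x, fun g hg => ?_⟩
    rcases Finset.mem_insert.mp hg with rfl | hg
    · rw [mul_assoc, ← huv, mul_inv_cancel_left]
      exact hv
    · rw [mul_assoc]
      exact M.mul_mem hu (hx g hg)

theorem finsum_mem_eq_finsum_of_forall_notMem {α A : Type*} [AddCommMonoid A] (S : Set α)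
    (f : α → A) (hf : ∀ a ∉ S, f a = 0) : ∑ᶠ a ∈ S, f a = ∑ᶠ a, f a := by
  refine finsum_congr fun a => ?_
  by_cases ha : a ∈ S
  · simp [ha]
  · simp [ha, hf a ha]

/-- Positive semidefiniteness over a generating submonoid implies positive
semidefiniteness over the whole group. -/
theorem stmt10
    (G : Type) [Group G] (M : Submonoid G)
    (hM : ∀ γ : G, ∃ u ∈ M, ∃ v ∈ M, u⁻¹ * v = γ)
    (E : Type) [NormedAddCommGroup E] [InnerProductSpace ℂ E] [CompleteSpace E]
    (N : ℕ) (hN : 0 < N)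
    (p : Fin N → Fin N → G → (E →L[ℂ] E))
    (hpsd : PSDoverFam (M : Set G) (Set.univ : Set (Fin N)) p) :
    PSDoverFam (Set.univ : Set G) (Set.univ : Set (Fin N)) p := by
  classical
  intro φ _
  obtain ⟨x, hx⟩ := M.exists_forall_mul_mem_of_finset hM
    (Finset.univ.biUnion fun j => (φ j).support)
  let ψ : Fin N → G →₀ E := fun j => Finsupp.equivMapDomain (Equiv.mulLeft x) (φ j)
  have hψ : ∀ j g, ψ j (x * g) = φ j g := fun j g => by
    simp [ψ, Finsupp.equivMapDomain_apply]
  have hψM : ∀ j, ∀ g ∉ M, ψ j g = 0 := fun j g hg => by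
    by_contra h
    rw [← mul_inv_cancel_left x g, hψ] at h
    refine hg ?_
    rw [← mul_inv_cancel_left x g]
    exact hx _ (Finset.mem_biUnion.mpr ⟨j, Finset.mem_univ j, Finsupp.mem_support_iff.mpr h⟩)
  have key : ∀ j k,
      ∑ᶠ g ∈ (M : Set G), ∑ᶠ h ∈ (M : Set G), ⟪ψ j g, p j k (g⁻¹ * h) (ψ k h)⟫ =
        ∑ᶠ g ∈ (Set.univ : Set G), ∑ᶠ h ∈ (Set.univ : Set G),
          ⟪φ j g, p j k (g⁻¹ * h) (φ k h)⟫ := fun j k => by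
    simp only [finsum_mem_univ]
    rw [finsum_mem_eq_finsum_of_forall_notMem _ _ fun g hg => by simp [hψM j g hg],
      ← finsum_comp_equiv (Equiv.mulLeft x)]
    refine finsum_congr fun g => ?_
    rw [finsum_mem_eq_finsum_of_forall_notMem _ _ fun h hh => by simp [hψM k h hh],
      ← finsum_comp_equiv (Equiv.mulLeft x)]
    refine finsum_congr fun h => ?_
    simp only [Equiv.coe_mulLeft, hψ, mul_inv_rev, mul_assoc, inv_mul_cancel_left]
  have main := hpsd ψ fun j g hg => by
    by_contra h
    exact Finsupp.mem_support_iff.mp hg (hψM j g h)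
  simpa only [key] using main
end

section
/- Let G be a group and M ⊆ G a submonoid with G = {u⁻¹v : u, v ∈ M}. Let E be a complex Hilbert space, F a finite set, s₀ ∈ F, and F₀ a proper subset of F ∖ {s₀}. Suppose functions p_{s,t} : G → B(E) are given for all pairs (s,t) ∈ F×F ∖ (({s₀}×F₀) ∪ (F₀×{s₀})), satisfying p_{t,s}(g) = (p_{s,t}(g⁻¹))* for all such pairs and all g ∈ G. If the families (p_{s,t}) indexed by (F∖{s₀})² and by (F∖F₀)² are both positive semidefinite over M, then there exist functions p_{s₀,t} : G → B(E) for t ∈ F₀ such that, setting p_{t,s₀}(g) = (p_{s₀,t}(g⁻¹))*, the full family (p_{s,t}) indexed by F×F is positive semidefinite over G. -/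
open scoped ComplexInnerProductSpace

/-- Two continuous linear maps agree if they agree on a family of vectors and on its orthogonal
complement. -/
lemma ContinuousLinearMap.eq_of_eq_on_family_of_eq_on_orthogonal {H H' X : Type*}
    [NormedAddCommGroup H] [InnerProductSpace ℂ H] [CompleteSpace H]
    [NormedAddCommGroup H'] [InnerProductSpace ℂ H']
    (v : X → H) {A B : H →L[ℂ] H'} (h : ∀ x, A (v x) = B (v x))
    (h' : ∀ z, (∀ x, ⟪v x, z⟫ = 0) → A z = B z) : A = B := by
  set N := (Submodule.span ℂ (Set.range v)).topologicalClosure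
  have hN : N ≤ (A - B).ker := by
    refine Submodule.topologicalClosure_minimal _ (Submodule.span_le.2 ?_)
      (A - B).isClosed_ker
    rintro _ ⟨x, rfl⟩
    simp [h]
  have hN' : Nᗮ ≤ (A - B).ker := fun z hz ↦ by
    have : ∀ x, ⟪v x, z⟫ = 0 := fun x ↦ Submodule.inner_right_of_mem_orthogonal
      (Submodule.le_topologicalClosure _ (Submodule.subset_span (Set.mem_range_self x))) hz
    simp [h' z this]
  have : CompleteSpace N := (Submodule.isClosed_topologicalClosure _).completeSpace_coe
  have htop : (A - B).ker = ⊤ := top_le_iff.1 <|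
    (Submodule.sup_orthogonal_of_hasOrthogonalProjection (K := N)).symm.le.trans (sup_le hN hN')
  ext z
  have : z ∈ (A - B).ker := htop ▸ Submodule.mem_top
  simpa [sub_eq_zero] using this

/-- Two families of vectors with the same Gram matrix are related by a partial isometry whose
initial space is the closed span of the first one. -/
lemma exists_partialIsometry_of_inner_eq {H H' X : Type*}
    [NormedAddCommGroup H] [InnerProductSpace ℂ H] [CompleteSpace H]
    [NormedAddCommGroup H'] [InnerProductSpace ℂ H'] [CompleteSpace H']
    (v : X → H) (w : X → H') (h : ∀ x y, ⟪v x, v y⟫ = ⟪w x, w y⟫) :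
    ∃ J : H →L[ℂ] H', (∀ x, J (v x) = w x) ∧ (∀ z, ‖J z‖ ≤ ‖z‖) ∧
      (∀ z, (∀ x, ⟪v x, z⟫ = 0) → J z = 0) ∧ ∀ x z, ⟪w x, J z⟫ = ⟪v x, z⟫ := by
  set N := (Submodule.span ℂ (Set.range v)).topologicalClosure with hNdef
  have : CompleteSpace N := (Submodule.isClosed_topologicalClosure _).completeSpace_coe
  have hmem : ∀ c, Finsupp.linearCombination ℂ v c ∈ N := fun c ↦
    Submodule.le_topologicalClosure _
      (by rw [← Finsupp.range_linearCombination]; exact LinearMap.mem_range_self _ c)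
  set e : (X →₀ ℂ) →ₗ[ℂ] N := (Finsupp.linearCombination ℂ v).codRestrict N hmem with hedef
  set f : (X →₀ ℂ) →ₗ[ℂ] H' := Finsupp.linearCombination ℂ w with hfdef
  have hdense : DenseRange e := by
    rw [DenseRange, Subtype.dense_iff]
    intro z hz
    have : Subtype.val '' Set.range e = (Submodule.span ℂ (Set.range v) : Set H) := by
      rw [← Finsupp.range_linearCombination, ← Set.range_comp]
      rfl
    exact (congrArg closure this).symm ▸ hz
  have hinner : ∀ c d, ⟪f c, f d⟫ = ⟪e c, e d⟫ := fun c d ↦ by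
    simp [hedef, hfdef, Finsupp.linearCombination_apply, Finsupp.sum_inner, Finsupp.inner_sum,
      inner_smul_left, inner_smul_right, h]
  have hnorm : ∀ c, ‖f c‖ = ‖e c‖ := fun c ↦ by
    rw [@norm_eq_sqrt_re_inner ℂ, @norm_eq_sqrt_re_inner ℂ, hinner]
  have hnorm' : ∀ c, ‖f c‖ ≤ 1 * ‖e c‖ := fun c ↦ by rw [one_mul, hnorm]
  set g : N →L[ℂ] H' := f.extendOfNorm e with hgdef
  have hg : ∀ c, g (e c) = f c := fun c ↦ LinearMap.extendOfNorm_eq hdense ⟨1, hnorm'⟩ c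
  have hgn : ∀ n, ‖g n‖ ≤ ‖n‖ := fun n ↦ by
    simpa using LinearMap.norm_extendOfNorm_apply_le hdense 1 hnorm' n
  have hv : ∀ x, v x ∈ N := fun x ↦
    Submodule.le_topologicalClosure _ (Submodule.subset_span ⟨x, rfl⟩)
  have hev : ∀ x, e (Finsupp.single x 1) = ⟨v x, hv x⟩ := fun x ↦ by
    ext; simp [hedef]
  have hgw : ∀ x n, ⟪w x, g n⟫ = ⟪v x, (n : H)⟫ := fun x n ↦ by
    refine congrFun (DenseRange.equalizer (g := fun n ↦ ⟪w x, g n⟫)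
      (h := fun n : N ↦ ⟪v x, (n : H)⟫) hdense (by fun_prop) (by fun_prop) ?_) n
    funext c
    have := hinner (Finsupp.single x 1) c
    rw [hev] at this
    simpa [hg, hfdef] using this
  refine ⟨g ∘L N.orthogonalProjectionOnto, fun x ↦ ?_, fun z ↦ ?_, fun z hz ↦ ?_, fun x z ↦ ?_⟩
  · have : N.orthogonalProjectionOnto (v x) = ⟨v x, hv x⟩ :=
      Submodule.orthogonalProjectionOnto_mem_subspace_eq_self (K := N) ⟨v x, hv x⟩
    rw [ContinuousLinearMap.comp_apply, this, ← hev, hg]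
    simp [hfdef]
  · exact (hgn _).trans (Submodule.norm_orthogonalProjectionOnto_apply_le N z)
  · have : z ∈ Nᗮ := by
      rw [hNdef, Submodule.orthogonal_closure]
      refine (Submodule.mem_orthogonal _ _).2 fun u hu ↦ ?_
      induction hu using Submodule.span_induction with
      | mem u hu => obtain ⟨x, rfl⟩ := hu; exact hz x
      | zero => simp
      | add a b _ _ ha hb => simp [inner_add_left, ha, hb]
      | smul c a _ ha => simp [inner_smul_left, ha]
    simp [Submodule.orthogonalProjectionOnto_apply_of_mem_orthogonal this]
  · rw [ContinuousLinearMap.comp_apply, hgw]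
    exact Submodule.inner_orthogonalProjectionOnto_eq_of_mem_left ⟨v x, hv x⟩ z

lemma finsum_mem_mem_eq_finsupp_sum {G E A : Type*} [Zero E] [AddCommMonoid A]
    {S : Set G} {a b : G →₀ E} (ha : (a.support : Set G) ⊆ S) (hb : (b.support : Set G) ⊆ S)
    (F : G → E → G → E → A) (hF₁ : ∀ g h f, F g 0 h f = 0) (hF₂ : ∀ g e h, F g e h 0 = 0) :
    ∑ᶠ g ∈ S, ∑ᶠ h ∈ S, F g (a g) h (b h) = a.sum fun g e ↦ b.sum fun h f ↦ F g e h f := by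
  have inner_eq : ∀ g, ∑ᶠ h ∈ S, F g (a g) h (b h) = b.sum fun h f ↦ F g (a g) h f := fun g ↦
    finsum_mem_eq_sum_of_subset _ (fun h hh ↦ by
      by_contra hb'
      exact hh.2 (by simp [Finsupp.notMem_support_iff.1 hb', hF₂])) hb
  simp_rw [inner_eq]
  exact finsum_mem_eq_sum_of_subset _ (fun g hg ↦ by
      by_contra ha'
      exact hg.2 (by simp [Finsupp.notMem_support_iff.1 ha', hF₁])) ha

/-- The sums in the definition of `PSDoverFam` as finite sums. -/
lemma finsum_kernel_eq_sum {ι G E : Type*} [Group G] [NormedAddCommGroup E]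
    [InnerProductSpace ℂ E] {S : Set G} {J : Set ι} (hJ : J.Finite)
    (p : ι → ι → G → (E →L[ℂ] E)) {φ : ι → G →₀ E}
    (hφ : ∀ j, ((φ j).support : Set G) ⊆ S) :
    ∑ᶠ j ∈ J, ∑ᶠ k ∈ J, ∑ᶠ g ∈ S, ∑ᶠ h ∈ S, ⟪φ j g, p j k (g⁻¹ * h) (φ k h)⟫ =
      ∑ j ∈ hJ.toFinset, ∑ k ∈ hJ.toFinset,
        (φ j).sum fun g e ↦ (φ k).sum fun h f ↦ ⟪e, p j k (g⁻¹ * h) f⟫ := by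
  rw [finsum_mem_eq_finite_toFinset_sum _ hJ]
  refine Finset.sum_congr rfl fun j _ ↦ ?_
  rw [finsum_mem_eq_finite_toFinset_sum _ hJ]
  refine Finset.sum_congr rfl fun k _ ↦ ?_
  exact finsum_mem_mem_eq_finsupp_sum (hφ j) (hφ k) (fun g e h f ↦ ⟪e, p j k (g⁻¹ * h) f⟫)
    (by simp) (by simp)

/-- Finitely many elements of a group generated by left fractions over `M` have a common left
denominator. -/
lemma Submonoid.exists_mul_mem_of_forall_eq_inv_mul {G : Type*} [Group G] {M : Submonoid G}
    (hM : ∀ γ : G, ∃ u ∈ M, ∃ v ∈ M, u⁻¹ * v = γ) (T : Finset G) :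
    ∃ w : G, ∀ g ∈ T, w * g ∈ M := by
  classical
  suffices ∃ w ∈ M, ∀ g ∈ T, w * g ∈ M from this.imp fun _ h ↦ h.2
  induction T using Finset.induction_on with
  | empty => exact ⟨1, M.one_mem, by simp⟩
  | insert a T _ ih =>
    obtain ⟨w, hwM, hw⟩ := ih
    obtain ⟨u, hu, v, hv, huv⟩ := hM (w * a)
    refine ⟨u * w, M.mul_mem hu hwM, fun g hg ↦ ?_⟩
    rcases Finset.mem_insert.1 hg with rfl | hg
    · rwa [mul_assoc, ← huv, mul_inv_cancel_left]
    · rw [mul_assoc]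
      exact M.mul_mem hu (hw g hg)

/-- Positive semidefiniteness over a submonoid generating the group by left fractions implies
positive semidefiniteness over the group. -/
lemma PSDoverFam.univ_of_submonoid {ι G E : Type*} [Group G] [NormedAddCommGroup E]
    [InnerProductSpace ℂ E] {M : Submonoid G} (hM : ∀ γ : G, ∃ u ∈ M, ∃ v ∈ M, u⁻¹ * v = γ)
    {J : Set ι} (hJ : J.Finite) {p : ι → ι → G → (E →L[ℂ] E)}
    (hp : PSDoverFam (M : Set G) J p) : PSDoverFam (Set.univ : Set G) J p := by
  classical
  intro φ hφ
  obtain ⟨w, hw⟩ := Submonoid.exists_mul_mem_of_forall_eq_inv_mul hM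
    (hJ.toFinset.biUnion fun j ↦ (φ j).support)
  set ψ : ι → G →₀ E := fun j ↦ if j ∈ J then (φ j).mapDomain (w * ·) else 0 with hψdef
  have hψ : ∀ j, ((ψ j).support : Set G) ⊆ M := by
    intro j x hx
    by_cases hj : j ∈ J
    · simp only [hψdef, hj, if_true] at hx
      obtain ⟨g, hg, rfl⟩ := Finset.mem_image.1 (Finsupp.mapDomain_support hx)
      exact hw g (Finset.mem_biUnion.2 ⟨j, hJ.mem_toFinset.2 hj, hg⟩)
    · simp [hψdef, hj] at hx
  have hsum : ∀ j ∈ J, ∀ k ∈ J, ((ψ j).sum fun g e ↦ (ψ k).sum fun h f ↦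
      ⟪e, p j k (g⁻¹ * h) f⟫) =
      (φ j).sum fun g e ↦ (φ k).sum fun h f ↦ ⟪e, p j k (g⁻¹ * h) f⟫ := fun j hj k hk ↦ by
    simp only [hψdef, hj, hk, if_true]
    rw [Finsupp.sum_mapDomain_index_inj (mul_right_injective w)]
    refine Finsupp.sum_congr fun g _ ↦ ?_
    rw [Finsupp.sum_mapDomain_index_inj (mul_right_injective w)]
    simp [mul_assoc]
  have key := hp ψ hψ
  rw [finsum_kernel_eq_sum hJ p hψ] at key
  rw [finsum_kernel_eq_sum hJ p hφ]
  rwa [Finset.sum_congr rfl fun j hj ↦ Finset.sum_congr rfl fun k hk ↦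
    hsum j (hJ.mem_toFinset.1 hj) k (hJ.mem_toFinset.1 hk)] at key

/-- Kolmogorov decomposition of a positive semidefinite family, with the translation operators. -/
lemma PSDoverFam.exists_dilation {ι G E : Type} [Group G] [NormedAddCommGroup E]
    [InnerProductSpace ℂ E] [CompleteSpace E] {J : Set ι} (hJ : J.Finite)
    {p : ι → ι → G → (E →L[ℂ] E)}
    (hsym : ∀ s ∈ J, ∀ t ∈ J, ∀ g, p t s g = ContinuousLinearMap.adjoint (p s t g⁻¹))
    (hp : PSDoverFam (Set.univ : Set G) J p) :
    ∃ (H : Type) (_ : NormedAddCommGroup H) (_ : InnerProductSpace ℂ H) (_ : CompleteSpace H)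
      (V : ι → G → E →L[ℂ] H) (U : G → H →L[ℂ] H),
      (∀ s ∈ J, ∀ t ∈ J, ∀ g h e f, ⟪V s g e, V t h f⟫ = ⟪e, p s t (g⁻¹ * h) f⟫) ∧
      (∀ k, ∀ t ∈ J, ∀ h f, U k (V t h f) = V t (k * h) f) ∧
      ∀ k x y, ⟪U k x, y⟫ = ⟪x, U k⁻¹ y⟫ := by
  classical
  have : Fintype J := hJ.fintype
  set K : Matrix (J × G) (J × G) (E →L[ℂ] E) := fun x y ↦ p x.1 y.1 (x.2⁻¹ * y.2) with hK
  have hherm : K.IsHermitian := by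
    ext x y : 1
    rw [Matrix.conjTranspose_apply, ContinuousLinearMap.star_eq_adjoint, hK]
    simp only
    rw [hsym y.1 y.1.2 x.1 x.1.2]
    simp
  have hpsd : K.PosSemidef := by
    refine ((RKHS.posSemidef_tfae (K := K)).out 0 2).2 (And.intro hherm fun vv ↦ ?_)
    set φ : ι → G →₀ E := fun j ↦ if h : j ∈ J then vv.curry ⟨j, h⟩ else 0 with hφ
    have key := (hp φ fun _ ↦ Set.subset_univ _).1
    rw [finsum_kernel_eq_sum hJ p fun _ ↦ Set.subset_univ _] at key
    have hcurry : ∀ F : J × G → E → ℂ,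
        vv.sum F = ∑ j : J, (vv.curry j).sum fun g e ↦ F (j, g) e := fun F ↦ by
      rw [← Finsupp.sum_fintype vv.curry (fun j l ↦ l.sum fun g e ↦ F (j, g) e) (by simp),
        Finsupp.sum_curry_index vv fun j g e ↦ F (j, g) e]
    have hφ' : ∀ j : J, φ j = vv.curry j := fun j ↦ by simp [hφ]
    have heq : (∑ j ∈ hJ.toFinset, ∑ k ∈ hJ.toFinset,
          (φ j).sum fun g e ↦ (φ k).sum fun h f ↦ ⟪e, p j k (g⁻¹ * h) f⟫) =
        vv.sum fun x' w' ↦ vv.sum fun x w ↦ ⟪w', K x' x w⟫ := by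
      rw [hcurry, Finset.sum_subtype hJ.toFinset fun _ ↦ hJ.mem_toFinset]
      refine Finset.sum_congr rfl fun j _ ↦ ?_
      rw [Finset.sum_subtype hJ.toFinset fun _ ↦ hJ.mem_toFinset, hφ']
      simp_rw [hcurry, hφ', Finsupp.sum]
      exact Finset.sum_comm
    rw [heq] at key
    rw [Finsupp.sum_comm, ← RCLike.conj_re]
    simpa [Finsupp.sum] using key
  have : Fact K.PosSemidef := ⟨hpsd⟩
  set V : ι → G → E →L[ℂ] RKHS.OfKernel K :=
    fun j g ↦ if h : j ∈ J then RKHS.kerFun (RKHS.OfKernel K) (⟨j, h⟩, g) else 0 with hV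
  have hVV : ∀ s ∈ J, ∀ t ∈ J, ∀ g h e f, ⟪V s g e, V t h f⟫ = ⟪e, p s t (g⁻¹ * h) f⟫ := by
    intro s hs t ht g h e f
    simp only [hV, hs, ht, dif_pos]
    rw [RKHS.kerFun_inner, RKHS.kerFun_apply, RKHS.OfKernel.kernel_ofKernel]
  have hU : ∀ k, ∃ U : RKHS.OfKernel K →L[ℂ] RKHS.OfKernel K,
      (∀ t ∈ J, ∀ h f, U (V t h f) = V t (k * h) f) ∧
      ∀ t ∈ J, ∀ h f z, ⟪V t (k * h) f, U z⟫ = ⟪V t h f, z⟫ := fun k ↦ by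
    obtain ⟨U, hU₁, -, -, hU₂⟩ := exists_partialIsometry_of_inner_eq
      (fun x : J × G × E ↦ V x.1 x.2.1 x.2.2) (fun x : J × G × E ↦ V x.1 (k * x.2.1) x.2.2)
      (fun x y ↦ by
        rw [hVV _ x.1.2 _ y.1.2, hVV _ x.1.2 _ y.1.2]
        simp [mul_assoc])
    exact ⟨U, fun t ht h f ↦ hU₁ (⟨t, ht⟩, h, f), fun t ht h f z ↦ hU₂ (⟨t, ht⟩, h, f) z⟩
  choose U hU hU' using hU
  refine ⟨RKHS.OfKernel K, inferInstance, inferInstance, inferInstance, V, U, hVV, hU,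
    fun k x y ↦ ?_⟩
  have hadj : ContinuousLinearMap.adjoint (U k) = U k⁻¹ := by
    refine ContinuousLinearMap.eq_of_eq_on_family_of_eq_on_orthogonal
      (fun x : J × G × E ↦ V x.1 x.2.1 x.2.2) (fun x ↦ ?_) fun z hz ↦ ?_
    · refine ext_inner_right ℂ fun z ↦ ?_
      rw [ContinuousLinearMap.adjoint_inner_left, hU _ _ x.1.2, ← hU' k _ x.1.2 (k⁻¹ * x.2.1),
        mul_inv_cancel_left]
    · have : z = 0 := RKHS.ext fun x ↦ ext_inner_left ℂ fun e ↦ by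
        have := hz (x.1, x.2, e)
        simp only [hV, x.1.2, dif_pos, RKHS.kerFun_inner] at this
        simpa using this
      simp [this]
  rw [← hadj, ContinuousLinearMap.adjoint_inner_right]

lemma sum_finsupp_sum_inner_eq_inner_self {ι G E H : Type*} [Zero E] [NormedAddCommGroup H]
    [InnerProductSpace ℂ H] (T : Finset ι) (φ : ι → G →₀ E) (B : ι → G → E → H) :
    ∑ j ∈ T, ∑ k ∈ T, ((φ j).sum fun g e ↦ (φ k).sum fun h f ↦ ⟪B j g e, B k h f⟫) =
      ⟪∑ j ∈ T, (φ j).sum (B j), ∑ j ∈ T, (φ j).sum (B j)⟫ := by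
  simp only [Finsupp.sum, sum_inner, inner_sum]
  rw [Finset.sum_comm]
  refine Finset.sum_congr rfl fun k _ ↦ ?_
  rw [Finset.sum_comm]
  exact Finset.sum_congr rfl fun j _ ↦ Finset.sum_comm

/-- Parrott-type psd completion from psd data over a generating submonoid. -/
theorem stmt11
    (G : Type) [Group G] (M : Submonoid G)
    (hM : ∀ γ : G, ∃ u ∈ M, ∃ v ∈ M, u⁻¹ * v = γ)
    (E : Type) [NormedAddCommGroup E] [InnerProductSpace ℂ E] [CompleteSpace E]
    (ι : Type) (S : Set ι) (hS : S.Finite) (s₀ : ι) (hs₀ : s₀ ∈ S)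
    (F₀ : Set ι) (hF₀ : F₀ ⊂ S \ {s₀})
    (p : ι → ι → G → (E →L[ℂ] E))
    (hsym : ∀ s t : ι, s ∈ S → t ∈ S →
      ¬(s = s₀ ∧ t ∈ F₀) → ¬(t = s₀ ∧ s ∈ F₀) →
      ∀ g : G, p t s g = ContinuousLinearMap.adjoint (p s t g⁻¹))
    (hP : PSDoverFam (M : Set G) (S \ {s₀}) p)
    (hQ : PSDoverFam (M : Set G) (S \ F₀) p) :
    ∃ q : ι → G → (E →L[ℂ] E), ∃ p' : ι → ι → G → (E →L[ℂ] E),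
      (∀ s t : ι, ¬(s = s₀ ∧ t ∈ F₀) → ¬(t = s₀ ∧ s ∈ F₀) → p' s t = p s t) ∧
      (∀ t ∈ F₀, p' s₀ t = q t) ∧
      (∀ t ∈ F₀, ∀ g : G, p' t s₀ g = ContinuousLinearMap.adjoint (q t g⁻¹)) ∧
      PSDoverFam (Set.univ : Set G) S p' := by
  classical
  have hs₀F : s₀ ∉ F₀ := fun h ↦ (hF₀.1 h).2 rfl
  have hPfin : (S \ {s₀}).Finite := hS.subset Set.sdiff_subset
  have hQfin : (S \ F₀).Finite := hS.subset Set.sdiff_subset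
  have hs₀Q : s₀ ∈ S \ F₀ := ⟨hs₀, hs₀F⟩
  obtain ⟨H, _, _, _, V, U, hV, hUV, hU⟩ := (hP.univ_of_submonoid hM hPfin).exists_dilation hPfin
    fun s hs t ht ↦ hsym s t hs.1 ht.1 (fun h ↦ hs.2 h.1) (fun h ↦ ht.2 h.1)
  obtain ⟨H', _, _, _, W, U', hW, hUW, hU'⟩ :=
    (hQ.univ_of_submonoid hM hQfin).exists_dilation hQfin
      fun s hs t ht ↦ hsym s t hs.1 ht.1 (fun h ↦ ht.2 h.2) (fun h ↦ hs.2 h.2)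
  have hKP : ∀ k : ↥((S \ {s₀}) ∩ (S \ F₀)), (k : ι) ∈ S \ {s₀} := fun k ↦ k.2.1
  have hKQ : ∀ k : ↥((S \ {s₀}) ∩ (S \ F₀)), (k : ι) ∈ S \ F₀ := fun k ↦ k.2.2
  obtain ⟨J, hJ, hJnorm, hJzero, -⟩ := exists_partialIsometry_of_inner_eq
    (fun x : ↥((S \ {s₀}) ∩ (S \ F₀)) × G × E ↦ V x.1 x.2.1 x.2.2) (fun x ↦ W x.1 x.2.1 x.2.2)
    fun x y ↦ by rw [hV _ (hKP _) _ (hKP _), hW _ (hKQ _) _ (hKQ _)]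
  have hJU : ∀ k, J ∘L U k = U' k ∘L J := fun k ↦ by
    refine ContinuousLinearMap.eq_of_eq_on_family_of_eq_on_orthogonal
      (fun x : ↥((S \ {s₀}) ∩ (S \ F₀)) × G × E ↦ V x.1 x.2.1 x.2.2) (fun x ↦ ?_) fun z hz ↦ ?_
    · have h₁ := hJ (x.1, k * x.2.1, x.2.2)
      simp only [ContinuousLinearMap.comp_apply] at h₁ ⊢
      rw [hJ x, hUV _ _ (hKP _), hUW _ _ (hKQ _), h₁]
    · have : J (U k z) = 0 := hJzero _ fun x ↦ by
        have h₁ := hz (x.1, k⁻¹ * x.2.1, x.2.2)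
        rw [← hUV _ _ (hKP _), hU, inv_inv] at h₁
        exact h₁
      simp [this, hJzero z hz]
  have hcross : ∀ t ∈ S \ {s₀}, ∀ g h e f,
      ⟪W s₀ 1 e, J (V t (g⁻¹ * h) f)⟫ = ⟪W s₀ g e, J (V t h f)⟫ := fun t ht g h e f ↦ by
    have h₁ := DFunLike.congr_fun (hJU g⁻¹) (V t h f)
    simp only [ContinuousLinearMap.comp_apply] at h₁
    rw [← hUV _ _ ht, h₁, ← hU', hUW _ _ hs₀Q, mul_one]
  set q : ι → G → (E →L[ℂ] E) :=
    fun t g ↦ ContinuousLinearMap.adjoint (W s₀ 1) ∘L J ∘L V t g with hq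
  set p' : ι → ι → G → (E →L[ℂ] E) := fun s t ↦ if s = s₀ ∧ t ∈ F₀ then q t else
    if t = s₀ ∧ s ∈ F₀ then fun g ↦ ContinuousLinearMap.adjoint (q s g⁻¹) else p s t with hp'
  have hp'q : ∀ t ∈ F₀, p' s₀ t = q t := fun t ht ↦ by simp [hp', ht]
  have hp'q' : ∀ t ∈ F₀, ∀ g, p' t s₀ g = ContinuousLinearMap.adjoint (q t g⁻¹) :=
    fun t ht g ↦ by simp [hp', ht, hs₀F]
  have hp'p : ∀ s t : ι, ¬(s = s₀ ∧ t ∈ F₀) → ¬(t = s₀ ∧ s ∈ F₀) → p' s t = p s t :=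
    fun s t h₁ h₂ ↦ by simp only [hp', h₁, h₂, if_false]
  refine ⟨q, p', hp'p, hp'q, hp'q', fun φ hφ ↦ ?_⟩
  set a : ι → G → E → H := fun j g e ↦ if j = s₀ then 0 else V j g e with ha
  set b : ι → G → E → H' := fun j g e ↦ if j = s₀ then W s₀ g e else J (V j g e) with hb
  have hrow : ∀ k ∈ S \ {s₀}, ∀ g h e f,
      ⟪e, p' s₀ k (g⁻¹ * h) f⟫ = ⟪W s₀ g e, J (V k h f)⟫ := fun k hk g h e f ↦ by
    by_cases hkF : k ∈ F₀
    · rw [hp'q k hkF, ← hcross k hk]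
      simp [hq, ContinuousLinearMap.adjoint_inner_right]
    · rw [hp'p _ _ (fun h ↦ hkF h.2) fun h ↦ hs₀F h.2, hJ (⟨k, hk, hk.1, hkF⟩, h, f),
        hW _ hs₀Q _ ⟨hk.1, hkF⟩]
  have hcol : ∀ j ∈ S \ {s₀}, ∀ g h e f,
      ⟪e, p' j s₀ (g⁻¹ * h) f⟫ = ⟪J (V j g e), W s₀ h f⟫ := fun j hj g h e f ↦ by
    have hjs : j ≠ s₀ := hj.2
    have : p' j s₀ (g⁻¹ * h) = ContinuousLinearMap.adjoint (p' s₀ j (h⁻¹ * g)) := by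
      by_cases hjF : j ∈ F₀
      · rw [hp'q' j hjF, hp'q j hjF, mul_inv_rev, inv_inv]
      · rw [hp'p _ _ (fun h ↦ hjs h.1) fun h ↦ hjF h.2,
          hp'p _ _ (fun h ↦ hjF h.2) fun h ↦ hs₀F h.2,
          hsym s₀ j hs₀ hj.1 (fun h ↦ hjF h.2) (fun h ↦ hs₀F h.2), mul_inv_rev, inv_inv]
    rw [this, ContinuousLinearMap.adjoint_inner_right, ← inner_conj_symm, hrow j hj,
      inner_conj_symm]
  have hentry : ∀ j ∈ S, ∀ k ∈ S, ∀ g h e f, ⟪e, p' j k (g⁻¹ * h) f⟫ =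
      ⟪b j g e, b k h f⟫ + ⟪a j g e, a k h f⟫ - ⟪J (a j g e), J (a k h f)⟫ := by
    intro j hj k hk g h e f
    by_cases hjs : j = s₀ <;> by_cases hks : k = s₀
    · subst hjs
      subst hks
      simp [ha, hb, hp'p _ _ (fun h ↦ hs₀F h.2) fun h ↦ hs₀F h.2, hW _ hs₀Q _ hs₀Q]
    · subst hjs
      simp [ha, hb, hks, hrow k ⟨hk, hks⟩]
    · subst hks
      simp [ha, hb, hjs, hcol j ⟨hj, hjs⟩]
    · simp [ha, hb, hjs, hks, hp'p j k (fun h ↦ hjs h.1) fun h ↦ hks h.1,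
        hV j ⟨hj, hjs⟩ k ⟨hk, hks⟩]
  rw [finsum_kernel_eq_sum hS p' hφ]
  set T := hS.toFinset
  have hsum : (∑ j ∈ T, ∑ k ∈ T,
        (φ j).sum fun g e ↦ (φ k).sum fun h f ↦ ⟪e, p' j k (g⁻¹ * h) f⟫) =
      ⟪∑ j ∈ T, (φ j).sum (b j), ∑ j ∈ T, (φ j).sum (b j)⟫ +
      ⟪∑ j ∈ T, (φ j).sum (a j), ∑ j ∈ T, (φ j).sum (a j)⟫ -
      ⟪J (∑ j ∈ T, (φ j).sum (a j)), J (∑ j ∈ T, (φ j).sum (a j))⟫ := by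
    have hJa : J (∑ j ∈ T, (φ j).sum (a j)) = ∑ j ∈ T, (φ j).sum fun g e ↦ J (a j g e) := by
      simp [Finsupp.sum]
    rw [hJa, ← sum_finsupp_sum_inner_eq_inner_self, ← sum_finsupp_sum_inner_eq_inner_self,
      ← sum_finsupp_sum_inner_eq_inner_self, ← Finset.sum_add_distrib, ← Finset.sum_sub_distrib]
    refine Finset.sum_congr rfl fun j hj ↦ ?_
    rw [← Finset.sum_add_distrib, ← Finset.sum_sub_distrib]
    refine Finset.sum_congr rfl fun k hk ↦ ?_
    rw [← Finsupp.sum_add, ← Finsupp.sum_sub]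
    refine Finsupp.sum_congr fun g _ ↦ ?_
    rw [← Finsupp.sum_add, ← Finsupp.sum_sub]
    exact Finsupp.sum_congr fun h _ ↦
      hentry j (hS.mem_toFinset.1 hj) k (hS.mem_toFinset.1 hk) g h _ _
  rw [hsum]
  generalize ∑ j ∈ T, (φ j).sum (a j) = x
  generalize ∑ j ∈ T, (φ j).sum (b j) = y
  simp only [inner_self_eq_norm_sq_to_K]
  norm_cast
  refine ⟨?_, Complex.ofReal_im _⟩
  change 0 ≤ ‖y‖ ^ 2 + ‖x‖ ^ 2 - ‖J x‖ ^ 2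
  linarith [sq_nonneg ‖y‖, pow_le_pow_left₀ (norm_nonneg _) (hJnorm x) 2]
end
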